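/- arXiv:1601.05959 — 3 statements merged into one kernel-verified Lean document; each statement's English description precedes it below -/
import Mathlib

section
/- Let n be even, let U ⊂ ℝⁿ be open and bounded, and let β ∈ (0,1) with nβ/2 − (n/2 − 1) > 0. For ω = (ωⁱⱼ) an antisymmetric n×n matrix of one-forms, let Ωⁱⱼ = dωⁱⱼ + Σₖ ωⁱₖ ∧ ωⱼᵏ and define the Gauss–Bonnet–Chern form Π(ω) = (1/πⁿ) Σ_{i=0}^{n/2−1} ((−1)^i / (1·3⋯(2n−2i−1) i! 2^{n+i})) Φ_i, where Φ_i = Σ_{ζ∈Sym(n), ζ(1)=1} sgn(ζ) ω¹_{ζ(2)} ∧ ω¹_{ζ(3)} ∧ … ∧ ω¹_{ζ(n−2i)} ∧ Ω^{ζ(n−2i+1)}_{ζ(n−2i+2)} ∧ … ∧ Ω^{ζ(n−1)}_{ζ(n)}. Then, writing Π(ω) as a linear combination of terms of the form ω_{i₁}^{i₂} ∧ … ∧ dω ∧ … (i.e., as a polynomial expression in the ωⁱⱼ and dωⁱⱼ), the map ω ↦ Π(ω) is continuous from C^{0,β}(U;Λ¹ℝⁿ)^{n×n} to X_θ for every θ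 ∈ (0,1) with θ < nβ/2 − (n/2 − 1). -/
noncomputable section

open Filter Set ENNReal MeasureTheory
open scoped Classical

/-! ## (n−1)-forms on `U ⊂ ℝⁿ` in coefficient representation, and the spaces `X₀`, `X₁`, `X_θ`.
An (n−1)-form is recorded by its coefficient functions `c x S` of `dx^0 ∧ ⋯ ∧ d̂x^S ∧ ⋯`. -/

/-- Exterior derivative of an (n−1)-form (the coefficient of the volume form). -/
def extDerivFm {n : ℕ} (c : EuclideanSpace ℝ (Fin n) → Fin n → ℝ)
    (x : EuclideanSpace ℝ (Fin n)) : ℝ :=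
  ∑ S : Fin n, (-1 : ℝ) ^ (S : ℕ) * fderiv ℝ (fun y => c y S) x (EuclideanSpace.single S 1)

/-- Sup norm (in `ℝ≥0∞`) of an (n−1)-form on `U`. -/
def eSupFm {n : ℕ} (U : Set (EuclideanSpace ℝ (Fin n)))
    (c : EuclideanSpace ℝ (Fin n) → Fin n → ℝ) : ℝ≥0∞ :=
  ⨆ x ∈ U, ⨆ S : Fin n, ENNReal.ofReal |c x S|

/-- Sup norm (in `ℝ≥0∞`) of a scalar function on `U`. -/
def eSupSc {n : ℕ} (U : Set (EuclideanSpace ℝ (Fin n)))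
    (f : EuclideanSpace ℝ (Fin n) → ℝ) : ℝ≥0∞ :=
  ⨆ x ∈ U, ENNReal.ofReal |f x|

/-- Smoothness of an (n−1)-form on `U`. -/
def SmoothFm {n : ℕ} (U : Set (EuclideanSpace ℝ (Fin n)))
    (c : EuclideanSpace ℝ (Fin n) → Fin n → ℝ) : Prop :=
  ∀ S : Fin n, ContDiffOn ℝ (⊤ : ℕ∞) (fun y => c y S) U

/-- Smooth closed (n−1)-forms on `U`. -/
def IsClosedFm {n : ℕ} (U : Set (EuclideanSpace ℝ (Fin n)))
    (c : EuclideanSpace ℝ (Fin n) → Fin n → ℝ) : Prop :=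
  SmoothFm U c ∧ ∀ x ∈ U, extDerivFm c x = 0

/-- The `X₀^{n−1}` norm: `inf { ‖c + a‖_{C⁰(U)} : a smooth closed }`. -/
def X0norm {n : ℕ} (U : Set (EuclideanSpace ℝ (Fin n)))
    (c : EuclideanSpace ℝ (Fin n) → Fin n → ℝ) : ℝ≥0∞ :=
  ⨅ (a : EuclideanSpace ℝ (Fin n) → Fin n → ℝ) (_ : IsClosedFm U a), eSupFm U (c + a)

/-- The `X₁^{n−1}` norm: `‖dc‖_{C⁰(U)}`. -/
def X1norm {n : ℕ} (U : Set (EuclideanSpace ℝ (Fin n)))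
    (c : EuclideanSpace ℝ (Fin n) → Fin n → ℝ) : ℝ≥0∞ :=
  eSupSc U (extDerivFm c)

/-- `u` (with pointwise derivative `u'`) is an admissible trace-method path for `c` in
`V(∞, 1−θ, X₁^{n−1}, X₀^{n−1})`, i.e. `u(0) = c` in `X₀`. -/
def IsVPathFm {n : ℕ} (U : Set (EuclideanSpace ℝ (Fin n))) (θ : ℝ)
    (c : EuclideanSpace ℝ (Fin n) → Fin n → ℝ)
    (u u' : ℝ → EuclideanSpace ℝ (Fin n) → Fin n → ℝ) : Prop :=
  (∀ t ∈ Set.Ioi (0:ℝ), SmoothFm U (u t)) ∧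
  (∀ x : EuclideanSpace ℝ (Fin n), ∀ S : Fin n, ∀ t ∈ Set.Ioi (0:ℝ),
    HasDerivAt (fun s => u s x S) (u' t x S) t) ∧
  Tendsto (fun t => X0norm U (u t - c)) (nhdsWithin 0 (Set.Ioi (0:ℝ))) (nhds 0)

/-- The norm of a path in `V(∞, 1−θ, X₁^{n−1}, X₀^{n−1})`. -/
def VnormFm {n : ℕ} (U : Set (EuclideanSpace ℝ (Fin n))) (θ : ℝ)
    (u u' : ℝ → EuclideanSpace ℝ (Fin n) → Fin n → ℝ) : ℝ≥0∞ :=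
  (⨆ t ∈ Set.Ioi (0:ℝ), ENNReal.ofReal (t ^ (1 - θ)) * X1norm U (u t)) +
  (⨆ t ∈ Set.Ioi (0:ℝ), ENNReal.ofReal (t ^ (1 - θ)) * X0norm U (u' t))

/-- The trace-method interpolation norm on `X_θ = (X₀^{n−1}, X₁^{n−1})_{θ,∞}` (computed on the
dense subspace of smooth forms). -/
def XthetaNorm {n : ℕ} (U : Set (EuclideanSpace ℝ (Fin n))) (θ : ℝ)
    (c : EuclideanSpace ℝ (Fin n) → Fin n → ℝ) : ℝ≥0∞ :=
  ⨅ (u : ℝ → EuclideanSpace ℝ (Fin n) → Fin n → ℝ)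
    (u' : ℝ → EuclideanSpace ℝ (Fin n) → Fin n → ℝ)
    (_ : IsVPathFm U θ c u u'), VnormFm U θ u u'

/-! ## Forms of general degree via the exterior algebra, and coefficient extraction -/

/-- Exterior algebra of covectors on `ℝⁿ`. -/
abbrev ExtAlg (n : ℕ) := ExteriorAlgebra ℝ (Fin n → ℝ)

/-- A covector as a degree-one element of the exterior algebra. -/
def ιv {n : ℕ} (c : Fin n → ℝ) : ExtAlg n := ExteriorAlgebra.ι ℝ c

/-- A `k`-form from its coefficient functions: `Σ_v c_v dx^{v 0} ∧ ⋯ ∧ dx^{v (k-1)}`. -/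
def formAlg {n : ℕ} (k : ℕ) (c : EuclideanSpace ℝ (Fin n) → (Fin k → Fin n) → ℝ)
    (x : EuclideanSpace ℝ (Fin n)) : ExtAlg n :=
  ∑ v : Fin k → Fin n, c x v • ((List.ofFn fun a : Fin k => ιv (Pi.single (v a) (1:ℝ))).prod)

/-- The exterior derivative of a `k`-form given in coefficients, as a `(k+1)`-form in the
exterior algebra: `Σ_{j,v} ∂_j c_v dx^j ∧ dx^{v}`. -/
def dFormAlg {n : ℕ} (k : ℕ) (c : EuclideanSpace ℝ (Fin n) → (Fin k → Fin n) → ℝ)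
    (x : EuclideanSpace ℝ (Fin n)) : ExtAlg n :=
  ∑ j : Fin n, ∑ v : Fin k → Fin n,
    (fderiv ℝ (fun y => c y v) x (EuclideanSpace.single j 1)) •
      (ιv (Pi.single j 1) * (List.ofFn fun a : Fin k => ιv (Pi.single (v a) (1:ℝ))).prod)

/-- The alternating (n−1)-form `(v₁,…,v_{n-1}) ↦ det[e_S, v₁, …, v_{n-1}]`. -/
def faceAlt (n : ℕ) (S : Fin n) : (Fin n → ℝ) [⋀^Fin (n-1)]→ₗ[ℝ] ℝ :=
  if h : n - 1 + 1 = n then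
    ((Matrix.detRowAlternating : (Fin n → ℝ) [⋀^Fin n]→ₗ[ℝ] ℝ).domDomCongr
        (finCongr h.symm)).curryLeft (Pi.single S 1)
  else 0

/-- Extraction of the coefficient functions of a homogeneous (n−1)-element of the exterior
algebra: `coeffFm m S` is the coefficient of `dx^0 ∧ ⋯ ∧ d̂x^S ∧ ⋯ ∧ dx^{n-1}`. -/
def coeffFm (n : ℕ) (m : ExtAlg n) (S : Fin n) : ℝ :=
  (-1 : ℝ) ^ (S : ℕ) *
    ExteriorAlgebra.liftAlternating
      (fun i => if h : i = n - 1 then (faceAlt n S).domDomCongr (finCongr h.symm) else 0) m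


/-- Exterior derivative `dω` of a one-form given by its coefficient functions. -/
def dOneAlg {n : ℕ} (c : EuclideanSpace ℝ (Fin n) → Fin n → ℝ)
    (x : EuclideanSpace ℝ (Fin n)) : ExtAlg n :=
  ∑ k : Fin n, ∑ l : Fin n,
    (fderiv ℝ (fun y => c y l) x (EuclideanSpace.single k 1)) •
      (ιv (Pi.single k 1) * ιv (Pi.single l 1))

/-- The curvature two-forms `Ωⁱⱼ = dωⁱⱼ + Σₖ ωⁱₖ ∧ ωᵏⱼ`. -/
def curvAlg {n : ℕ} (ω : Fin n → Fin n → EuclideanSpace ℝ (Fin n) → Fin n → ℝ)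
    (i j : Fin n) (x : EuclideanSpace ℝ (Fin n)) : ExtAlg n :=
  dOneAlg (ω i j) x + ∑ k : Fin n, ιv (ω i k x) * ιv (ω k j x)

/-- The (n−1)-form `Φ_i = Σ_{ζ(1)=1} sgn ζ · ω¹_{ζ(2)} ∧ ⋯ ∧ ω¹_{ζ(n−2i)} ∧
Ω^{ζ(n−2i+1)}_{ζ(n−2i+2)} ∧ ⋯ ∧ Ω^{ζ(n−1)}_{ζ(n)}`. -/
def PhiAlg {n : ℕ} (hn : 0 < n)
    (ω : Fin n → Fin n → EuclideanSpace ℝ (Fin n) → Fin n → ℝ)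
    (i : ℕ) (hi : i < n / 2) (x : EuclideanSpace ℝ (Fin n)) : ExtAlg n :=
  ∑ ζ ∈ Finset.univ.filter (fun ζ : Equiv.Perm (Fin n) => ζ ⟨0, hn⟩ = ⟨0, hn⟩),
    (Equiv.Perm.sign ζ : ℤ) •
      (((List.ofFn fun j : Fin (n - 2*i - 1) =>
          ιv (ω ⟨0, hn⟩ (ζ ⟨j.1 + 1, by have := j.2; omega⟩) x)) ++
        (List.ofFn fun j : Fin i =>
          curvAlg ω (ζ ⟨n - 2*i + 2*j.1, by have h1 := j.2; have h2 := hi; omega⟩)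
            (ζ ⟨n - 2*i + 2*j.1 + 1, by have h1 := j.2; have h2 := hi; omega⟩) x)).prod)

/-- The Gauss–Bonnet–Chern primitive
`Π(ω) = π^{-n} Σ_{i=0}^{n/2−1} ((−1)^i / (1·3⋯(2n−2i−1) i! 2^{n+i})) Φ_i`,
as an (n−1)-form in coefficient representation. -/
def GBCPrimitive {n : ℕ} (hn : 0 < n)
    (ω : Fin n → Fin n → EuclideanSpace ℝ (Fin n) → Fin n → ℝ)
    (x : EuclideanSpace ℝ (Fin n)) (S : Fin n) : ℝ :=
  coeffFm n
    ((Real.pi ^ n)⁻¹ •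
      ∑ i : Fin (n / 2),
        (((-1 : ℝ) ^ (i : ℕ)) /
            ((∏ j ∈ Finset.range (n - i), (2 * (j:ℝ) + 1)) *
              (Nat.factorial i) * 2 ^ (n + (i:ℕ)))) •
          PhiAlg hn ω i.1 i.2 x) S

/-- Smoothness of a matrix of one-forms on `U`. -/
def SmoothOneForms {n : ℕ} (U : Set (EuclideanSpace ℝ (Fin n)))
    (ω : Fin n → Fin n → EuclideanSpace ℝ (Fin n) → Fin n → ℝ) : Prop :=
  ∀ i j k, ContDiffOn ℝ (⊤ : ℕ∞) (fun x => ω i j x k) U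

/-- `N` bounds the `C^{0,β}(U;Λ¹ℝⁿ)^{n×n}` norm of a matrix of one-forms. -/
def C0βBoundForms {n : ℕ} (U : Set (EuclideanSpace ℝ (Fin n))) (β : ℝ)
    (ω : Fin n → Fin n → EuclideanSpace ℝ (Fin n) → Fin n → ℝ) (N : ℝ) : Prop :=
  (∀ i j k, ∀ x ∈ U, |ω i j x k| ≤ N) ∧
  (∀ i j k, ∀ x ∈ U, ∀ x' ∈ U, |ω i j x k - ω i j x' k| ≤ N * dist x x' ^ β)

open scoped Topology

/-- The determinant as a continuous multilinear map of the rows. -/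
def rowDet (n : ℕ) : ContinuousMultilinearMap ℝ (fun _ : Fin n => Fin n → ℝ) ℝ where
  toMultilinearMap := (Matrix.detRowAlternating : (Fin n → ℝ) [⋀^Fin n]→ₗ[ℝ] ℝ).toMultilinearMap
  cont := (Continuous.matrix_det (A := fun M : Matrix (Fin n) (Fin n) ℝ => M) continuous_id)

lemma rowDet_apply {n : ℕ} (M : Fin n → Fin n → ℝ) : rowDet n M = Matrix.det (Matrix.of M) := rfl

lemma rowDet_swap_update {n : ℕ} (G : Fin n → Fin n → ℝ) {b i : Fin n} (h : i ≠ b)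
    (v w : Fin n → ℝ) :
    rowDet n (Function.update (Function.update G b v) i w) =
      - rowDet n (Function.update (Function.update G b w) i v) := by
  have h1 := (Matrix.detRowAlternating : (Fin n → ℝ) [⋀^Fin n]→ₗ[ℝ] ℝ).map_swap
    (Function.update (Function.update G b w) i v) h
  have h2 : (Function.update (Function.update G b w) i v) ∘ Equiv.swap i b =
      Function.update (Function.update G b v) i w := by
    funext j
    by_cases hi : j = i
    · subst hi; simp [h.symm]
    · by_cases hb : j = b
      · subst hb; simp [hi]
      · simp [Equiv.swap_apply_of_ne_of_ne hi hb, hi, hb]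
  rw [h2] at h1
  exact h1

lemma rowDet_update_sum_single {n : ℕ} (G : Fin n → Fin n → ℝ) (i : Fin n) (w : Fin n → ℝ) :
    rowDet n (Function.update G i w) =
      ∑ k, w k * rowDet n (Function.update G i (Pi.single k 1)) := by
  conv_lhs => rw [← Finset.univ_sum_single w]
  refine ((rowDet n).toMultilinearMap.map_update_sum Finset.univ i _ G).trans ?_
  refine Finset.sum_congr rfl fun k _ => ?_
  have : (Pi.single k (w k) : Fin n → ℝ) = w k • Pi.single k 1 := by
    rw [← Pi.single_smul]; simp
  rw [this]
  exact (rowDet n).toMultilinearMap.map_update_smul G i (w k) (Pi.single k 1)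

lemma abs_rowDet_le {n : ℕ} (M : Fin n → Fin n → ℝ) (a : Fin n → ℝ)
    (h : ∀ i k, |M i k| ≤ a i) : |rowDet n M| ≤ n.factorial * ∏ i, a i := by
  rw [rowDet_apply, Matrix.det_apply']
  refine (Finset.abs_sum_le_sum_abs _ _).trans ?_
  have : ∀ σ ∈ (Finset.univ : Finset (Equiv.Perm (Fin n))),
      |((Equiv.Perm.sign σ : ℤ) : ℝ) * ∏ i, Matrix.of M (σ i) i| ≤ ∏ i, a i := by
    intro σ _
    rw [abs_mul, Finset.abs_prod]
    have h1 : |((Equiv.Perm.sign σ : ℤ) : ℝ)| = 1 := by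
      rcases Int.units_eq_one_or (Equiv.Perm.sign σ) with h | h <;> simp [h]
    rw [h1, one_mul, ← Equiv.prod_comp σ a]
    exact Finset.prod_le_prod (fun i _ => abs_nonneg _) (fun i _ => h _ _)
  refine (Finset.sum_le_card_nsmul _ _ _ this).trans ?_
  simp [Finset.card_univ, Fintype.card_perm]

section Piola

variable {X : Type*} [NormedAddCommGroup X] [NormedSpace ℝ X] {n : ℕ}

/-- The matrix of derivatives of the functions `g j` in the directions `d k`. -/
def jac (d : Fin n → X) (g : Fin n → X → ℝ) (p : X) : Fin n → Fin n → ℝ :=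
  fun j k => fderiv ℝ (g j) p (d k)

lemma hasFDerivAt_fderiv_apply {g : X → ℝ} {p : X} (hg : ContDiffAt ℝ 2 g p) (v : X) :
    HasFDerivAt (fun q => fderiv ℝ g q v) ((fderiv ℝ (fderiv ℝ g) p).flip v) p := by
  have h : DifferentiableAt ℝ (fderiv ℝ g) p :=
    (hg.fderiv_right (m := 1) (by norm_num)).differentiableAt (by norm_num)
  simpa using h.hasFDerivAt.clm_apply (hasFDerivAt_const v p)

lemma fderiv_fderiv_comm {g : X → ℝ} {p : X} (hg : ContDiffAt ℝ 2 g p) (v w : X) :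
    fderiv ℝ (fderiv ℝ g) p v w = fderiv ℝ (fderiv ℝ g) p w v :=
  (hg.isSymmSndFDerivAt (by simp)).eq v w

lemma hasFDerivAt_jac_row {d : Fin n → X} {g : Fin n → X → ℝ} {p : X}
    (hg : ∀ j, ContDiffAt ℝ 2 (g j) p) (j : Fin n) :
    HasFDerivAt (fun q => jac d g q j)
      (ContinuousLinearMap.pi fun k => (fderiv ℝ (fderiv ℝ (g j)) p).flip (d k)) p :=
  hasFDerivAt_pi.2 fun k => hasFDerivAt_fderiv_apply (hg j) (d k)

/-- Piola's identity: the rows of the cofactor matrix of a Jacobian are divergence free. -/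
lemma sum_fderiv_mul_rowDet_update {d : Fin n → X} {g : Fin n → X → ℝ} {φ : X → ℝ} {p : X}
    (hg : ∀ j, ContDiffAt ℝ 2 (g j) p) (hφ : DifferentiableAt ℝ φ p) (b : Fin n) :
    ∑ S, fderiv ℝ (fun q => φ q * rowDet n (Function.update (jac d g q) b (Pi.single S 1))) p (d S)
      = rowDet n (Function.update (jac d g p) b (fun k => fderiv ℝ φ p (d k))) := by
  let r' : Fin n → X →L[ℝ] (Fin n → ℝ) := fun i => if i = b then 0 else
    ContinuousLinearMap.pi fun k => (fderiv ℝ (fderiv ℝ (g i)) p).flip (d k)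
  have hrow : ∀ S i, HasFDerivAt
      (fun q => Function.update (jac d g q) b (Pi.single S 1 : Fin n → ℝ) i) (r' i) p := by
    intro S i
    by_cases hi : i = b
    · subst hi
      simpa [r'] using hasFDerivAt_const (𝕜 := ℝ) (Pi.single S 1 : Fin n → ℝ) p
    · simpa [r', hi] using hasFDerivAt_jac_row hg i
  have hdet : ∀ S, HasFDerivAt
      (fun q => rowDet n (Function.update (jac d g q) b (Pi.single S 1 : Fin n → ℝ)))
      (∑ i, ((rowDet n).toContinuousLinearMap
        (Function.update (jac d g p) b (Pi.single S 1 : Fin n → ℝ)) i) ∘L (r' i)) p :=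
    fun S => HasFDerivAt.multilinear_comp (rowDet n) (hrow S)
  have key : ∀ i, ∑ S, rowDet n (Function.update
      (Function.update (jac d g p) b (Pi.single S 1 : Fin n → ℝ)) i (r' i (d S))) = 0 := by
    intro i
    by_cases hi : i = b
    · refine Finset.sum_eq_zero fun S _ => ?_
      simp only [r', hi, if_true, zero_apply]
      exact ContinuousMultilinearMap.map_coord_zero _ b (by simp)
    · have h1 : ∀ S, rowDet n (Function.update
          (Function.update (jac d g p) b (Pi.single S 1 : Fin n → ℝ)) i (r' i (d S))) =
          ∑ k, fderiv ℝ (fderiv ℝ (g i)) p (d S) (d k) * rowDet n (Function.update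
          (Function.update (jac d g p) b (Pi.single S 1 : Fin n → ℝ)) i (Pi.single k 1)) := by
        intro S
        rw [rowDet_update_sum_single]
        simp [r', hi]
      simp_rw [h1]
      have h2 : ∀ a : ℝ, a = -a → a = 0 := fun a h => by linarith
      apply h2
      conv_lhs => rw [Finset.sum_comm]
      rw [← Finset.sum_neg_distrib]
      refine Finset.sum_congr rfl fun S _ => ?_
      rw [← Finset.sum_neg_distrib]
      refine Finset.sum_congr rfl fun k _ => ?_
      rw [rowDet_swap_update _ hi, fderiv_fderiv_comm (hg i)]
      ring
  have hS : ∀ S, fderiv ℝ (fun q => φ q * rowDet n (Function.update (jac d g q) b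
        (Pi.single S 1))) p (d S) =
      fderiv ℝ φ p (d S) * rowDet n (Function.update (jac d g p) b (Pi.single S 1)) +
      φ p * ∑ i, rowDet n (Function.update
      (Function.update (jac d g p) b (Pi.single S 1 : Fin n → ℝ)) i (r' i (d S))) := by
    intro S
    rw [(hφ.hasFDerivAt.fun_mul (hdet S)).fderiv]
    simp [ContinuousMultilinearMap.toContinuousLinearMap]
    ring
  simp_rw [hS, Finset.sum_add_distrib, ← Finset.mul_sum]
  rw [Finset.sum_comm]
  simp_rw [key]
  rw [rowDet_update_sum_single]
  simp

lemma fderiv_rowDet_jac {d : Fin n → X} {g : Fin n → X → ℝ} {p : X}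
    (hg : ∀ j, ContDiffAt ℝ 2 (g j) p) (v : X) :
    fderiv ℝ (fun q => rowDet n (jac d g q)) p v =
      ∑ b, rowDet n (Function.update (jac d g p) b
        (fun k => fderiv ℝ (fun q => fderiv ℝ (g b) q v) p (d k))) := by
  rw [(HasFDerivAt.multilinear_comp (rowDet n) (fun i => hasFDerivAt_jac_row hg i)).fderiv]
  simp only [sum_apply, ContinuousLinearMap.comp_apply,
    ContinuousMultilinearMap.toContinuousLinearMap_apply]
  refine Finset.sum_congr rfl fun b _ => ?_
  congr 2
  funext k
  rw [(hasFDerivAt_fderiv_apply (hg b) v).fderiv]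
  simp [fderiv_fderiv_comm (hg b) v (d k)]

/-- The vector field whose divergence is the derivative of the Jacobian determinant in the
direction `v`. -/
def jacFlux (d : Fin n → X) (g : Fin n → X → ℝ) (v : X) (S : Fin n) (p : X) : ℝ :=
  ∑ b, fderiv ℝ (g b) p v * rowDet n (Function.update (jac d g p) b (Pi.single S 1))

lemma contDiffOn_jac_row {m : ℕ∞} {W : Set X} (hW : IsOpen W) {d : Fin n → X}
    {g : Fin n → X → ℝ} (hg : ∀ j, ContDiffOn ℝ (⊤ : ℕ∞) (g j) W) (j : Fin n) :
    ContDiffOn ℝ m (fun q => jac d g q j) W := by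
  refine contDiffOn_pi.2 fun k => ?_
  exact ((hg j).fderiv_of_isOpen (m := m) hW (by exact_mod_cast le_top)).clm_apply contDiffOn_const

lemma contDiffOn_mul_rowDet_update {W : Set X} (hW : IsOpen W) {d : Fin n → X}
    {g : Fin n → X → ℝ} (hg : ∀ j, ContDiffOn ℝ (⊤ : ℕ∞) (g j) W) {φ : X → ℝ}
    (hφ : ContDiffOn ℝ (⊤ : ℕ∞) φ W) (b S : Fin n) :
    ContDiffOn ℝ (⊤ : ℕ∞) (fun q => φ q * rowDet n (Function.update (jac d g q) b
        (Pi.single S 1))) W := by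
  refine hφ.mul ?_
  refine (rowDet n).contDiff.comp_contDiffOn (contDiffOn_pi.2 fun i => ?_)
  by_cases hi : i = b
  · subst hi
    simpa using contDiffOn_const
  · simpa [hi] using contDiffOn_jac_row hW hg i

lemma contDiffOn_rowDet_jac {W : Set X} (hW : IsOpen W) {d : Fin n → X}
    {g : Fin n → X → ℝ} (hg : ∀ j, ContDiffOn ℝ (⊤ : ℕ∞) (g j) W) :
    ContDiffOn ℝ (⊤ : ℕ∞) (fun q => rowDet n (jac d g q)) W :=
  (rowDet n).contDiff.comp_contDiffOn (contDiffOn_pi.2 fun i => contDiffOn_jac_row hW hg i)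

lemma contDiffOn_fderiv_apply {W : Set X} (hW : IsOpen W) {g : X → ℝ}
    (hg : ContDiffOn ℝ (⊤ : ℕ∞) g W) (v : X) :
    ContDiffOn ℝ (⊤ : ℕ∞) (fun q => fderiv ℝ g q v) W :=
  (hg.fderiv_of_isOpen (m := (⊤ : ℕ∞)) hW (by exact_mod_cast le_top)).clm_apply contDiffOn_const

lemma contDiffOn_jacFlux {W : Set X} (hW : IsOpen W) {d : Fin n → X}
    {g : Fin n → X → ℝ} (hg : ∀ j, ContDiffOn ℝ (⊤ : ℕ∞) (g j) W) (v : X) (S : Fin n) :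
    ContDiffOn ℝ (⊤ : ℕ∞) (jacFlux d g v S) W :=
  ContDiffOn.sum fun b _ =>
    contDiffOn_mul_rowDet_update hW hg (contDiffOn_fderiv_apply hW (hg b) v) b S

lemma sum_fderiv_jacFlux {W : Set X} (hW : IsOpen W) {d : Fin n → X}
    {g : Fin n → X → ℝ} (hg : ∀ j, ContDiffOn ℝ (⊤ : ℕ∞) (g j) W) (v : X) {p : X} (hp : p ∈ W) :
    ∑ S, fderiv ℝ (jacFlux d g v S) p (d S) = fderiv ℝ (fun q => rowDet n (jac d g q)) p v := by
  have hp' := hW.mem_nhds hp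
  have hg2 : ∀ j, ContDiffAt ℝ 2 (g j) p := fun j =>
    ((hg j).contDiffAt hp').of_le (WithTop.coe_le_coe.2 (le_top (a := (2 : ℕ∞))))
  have hT : ∀ b, ContDiffOn ℝ (⊤ : ℕ∞) (fun q => fderiv ℝ (g b) q v) W :=
    fun b => contDiffOn_fderiv_apply hW (hg b) v
  have hd : ∀ b S, DifferentiableAt ℝ (fun q => fderiv ℝ (g b) q v *
      rowDet n (Function.update (jac d g q) b (Pi.single S 1))) p := fun b S =>
    ((contDiffOn_mul_rowDet_update hW hg (hT b) b S).contDiffAt hp').differentiableAt (by simp)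
  rw [fderiv_rowDet_jac hg2]
  have : ∀ S, fderiv ℝ (jacFlux d g v S) p (d S) = ∑ b, fderiv ℝ (fun q => fderiv ℝ (g b) q v *
      rowDet n (Function.update (jac d g q) b (Pi.single S 1))) p (d S) := by
    intro S
    unfold jacFlux
    rw [fderiv_fun_sum fun b _ => hd b S]
    simp
  simp_rw [this]
  rw [Finset.sum_comm]
  exact Finset.sum_congr rfl fun b _ =>
    sum_fderiv_mul_rowDet_update hg2 (((hT b).contDiffAt hp').differentiableAt (by simp)) b

end Piola

section ParametricIntegral

variable {E : Type} [NormedAddCommGroup E] [NormedSpace ℝ E] [ProperSpace E]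

/-- Differentiation under the integral sign for a jointly `C^1` integrand. -/
lemma hasFDerivAt_intervalIntegral_of_contDiffOn {V : Type} [NormedAddCommGroup V]
    [NormedSpace ℝ V] [CompleteSpace V] {U : Set E} (hU : IsOpen U) {ρ : ℝ × E → V}
    (hρ : ContDiffOn ℝ 1 ρ (univ ×ˢ U)) (t : ℝ) {x₀ : E} (hx₀ : x₀ ∈ U) :
    HasFDerivAt (fun x => ∫ τ in (0 : ℝ)..t, ρ (τ, x))
      (∫ τ in (0 : ℝ)..t, (fderiv ℝ ρ (τ, x₀)).comp (ContinuousLinearMap.inr ℝ ℝ E)) x₀ := by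
  have hW : IsOpen ((univ : Set ℝ) ×ˢ U) := isOpen_univ.prod hU
  obtain ⟨r, hr, hrU⟩ := Metric.nhds_basis_closedBall.mem_iff.1 (hU.mem_nhds hx₀)
  have hsl : ∀ x ∈ U, Continuous fun τ : ℝ => ((τ, x) : ℝ × E) := fun x _ => by fun_prop
  have hc : ∀ x ∈ U, Continuous fun τ : ℝ => ρ (τ, x) := fun x hx =>
    hρ.continuousOn.comp_continuous (hsl x hx) fun τ => ⟨mem_univ _, hx⟩
  have hD : ContinuousOn (fun p => (fderiv ℝ ρ p).comp (ContinuousLinearMap.inr ℝ ℝ E))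
      (univ ×ˢ U) :=
    (hρ.continuousOn_fderiv_of_isOpen hW le_rfl).clm_comp continuousOn_const
  have hDc : ∀ x ∈ U, Continuous fun τ : ℝ =>
      (fderiv ℝ ρ (τ, x)).comp (ContinuousLinearMap.inr ℝ ℝ E) := fun x hx =>
    hD.comp_continuous (hsl x hx) fun τ => ⟨mem_univ _, hx⟩
  obtain ⟨C, hC⟩ := ((isCompact_uIcc (a := (0 : ℝ)) (b := t)).prod
    (isCompact_closedBall x₀ r)).exists_bound_of_continuousOn
    (hD.mono (prod_mono (subset_univ _) hrU))
  refine intervalIntegral.hasFDerivAt_integral_of_dominated_of_fderiv_le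
    (F := fun x τ => ρ (τ, x))
    (F' := fun x τ => (fderiv ℝ ρ (τ, x)).comp (ContinuousLinearMap.inr ℝ ℝ E))
    (s := Metric.closedBall x₀ r) (bound := fun _ => C)
    (Metric.closedBall_mem_nhds x₀ hr) ?_ ?_ ?_ ?_ ?_ ?_
  · filter_upwards [hU.mem_nhds hx₀] with x hx
    exact (hc x hx).aestronglyMeasurable
  · exact (hc x₀ hx₀).intervalIntegrable _ _
  · exact (hDc x₀ hx₀).aestronglyMeasurable
  · exact Eventually.of_forall fun τ hτ x hx => hC (τ, x) ⟨uIoc_subset_uIcc hτ, hx⟩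
  · exact intervalIntegrable_const
  · refine Eventually.of_forall fun τ _ x hx => ?_
    have h1 : HasFDerivAt ρ (fderiv ℝ ρ (τ, x)) (τ, x) :=
      ((hρ.contDiffAt (hW.mem_nhds ⟨mem_univ _, hrU hx⟩)).differentiableAt
        (by norm_num)).hasFDerivAt
    exact h1.comp x (hasFDerivAt_prodMk_right τ x)

lemma contDiffOn_intervalIntegral_nat {U : Set E} (hU : IsOpen U) (t : ℝ) (k : ℕ) :
    ∀ {V : Type} [NormedAddCommGroup V] [NormedSpace ℝ V] [CompleteSpace V] {ρ : ℝ × E → V},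
      ContDiffOn ℝ (⊤ : ℕ∞) ρ (univ ×ˢ U) →
      ContDiffOn ℝ k (fun x => ∫ τ in (0 : ℝ)..t, ρ (τ, x)) U := by
  have hW : IsOpen ((univ : Set ℝ) ×ˢ U) := isOpen_univ.prod hU
  have h1 : ∀ {V : Type} [NormedAddCommGroup V] [NormedSpace ℝ V] [CompleteSpace V]
      {ρ : ℝ × E → V}, ContDiffOn ℝ (⊤ : ℕ∞) ρ (univ ×ˢ U) → ∀ x ∈ U,
      HasFDerivAt (fun x => ∫ τ in (0 : ℝ)..t, ρ (τ, x))
      (∫ τ in (0 : ℝ)..t, (fderiv ℝ ρ (τ, x)).comp (ContinuousLinearMap.inr ℝ ℝ E)) x :=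
    fun hρ x hx => hasFDerivAt_intervalIntegral_of_contDiffOn hU
      (hρ.of_le (WithTop.coe_le_coe.2 (le_top (a := (1 : ℕ∞))))) t hx
  induction k with
  | zero =>
    intro V _ _ _ ρ hρ
    exact contDiffOn_zero.2 fun x hx => (h1 hρ x hx).continuousAt.continuousWithinAt
  | succ k ih =>
    intro V _ _ _ ρ hρ
    push_cast
    refine (contDiffOn_succ_iff_fderiv_of_isOpen hU).2 ⟨fun x hx =>
      (h1 hρ x hx).differentiableAt.differentiableWithinAt, by simp, ?_⟩
    have h2 : ContDiffOn ℝ (⊤ : ℕ∞)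
        (fun p => (fderiv ℝ ρ p).comp (ContinuousLinearMap.inr ℝ ℝ E)) (univ ×ˢ U) :=
      (hρ.fderiv_of_isOpen (m := (⊤ : ℕ∞)) hW (by exact_mod_cast le_top)).clm_comp
        contDiffOn_const
    exact (ih h2).congr fun x hx => (h1 hρ x hx).fderiv

lemma contDiffOn_intervalIntegral {V : Type} [NormedAddCommGroup V] [NormedSpace ℝ V]
    [CompleteSpace V] {U : Set E} (hU : IsOpen U) (t : ℝ) {ρ : ℝ × E → V}
    (hρ : ContDiffOn ℝ (⊤ : ℕ∞) ρ (univ ×ˢ U)) :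
    ContDiffOn ℝ (⊤ : ℕ∞) (fun x => ∫ τ in (0 : ℝ)..t, ρ (τ, x)) U :=
  contDiffOn_infty.2 fun k => contDiffOn_intervalIntegral_nat hU t k hρ

end ParametricIntegral

section Paths

variable {n : ℕ} {U : Set (EuclideanSpace ℝ (Fin n))} {θ : ℝ}

/-- `c` is the initial value of a trace-method path which converges uniformly on `U` and satisfies
the weighted sup bounds with constant `K`. -/
def HasPath (U : Set (EuclideanSpace ℝ (Fin n))) (θ : ℝ)
    (c : EuclideanSpace ℝ (Fin n) → Fin n → ℝ) (K : ℝ) : Prop :=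
  ∃ u u' : ℝ → EuclideanSpace ℝ (Fin n) → Fin n → ℝ,
    (∀ t > 0, SmoothFm U (u t)) ∧
    (∀ x S, ∀ t > 0, HasDerivAt (fun s => u s x S) (u' t x S) t) ∧
    (∃ e : ℝ → ℝ, Tendsto e (𝓝[>] 0) (𝓝 0) ∧
      ∀ t > 0, ∀ x ∈ U, ∀ S, |u t x S - c x S| ≤ e t) ∧
    (∀ t > 0, ∀ x ∈ U, t ^ (1 - θ) * |extDerivFm (u t) x| ≤ K) ∧
    (∀ t > 0, ∀ x ∈ U, ∀ S, t ^ (1 - θ) * |u' t x S| ≤ K)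

lemma SmoothFm.differentiableAt {c : EuclideanSpace ℝ (Fin n) → Fin n → ℝ} (hU : IsOpen U)
    (hc : SmoothFm U c) {x : EuclideanSpace ℝ (Fin n)} (hx : x ∈ U) (S : Fin n) :
    DifferentiableAt ℝ (fun y => c y S) x :=
  ((hc S).contDiffAt (hU.mem_nhds hx)).differentiableAt (by simp)

lemma extDerivFm_add (hU : IsOpen U) {c d : EuclideanSpace ℝ (Fin n) → Fin n → ℝ}
    (hc : SmoothFm U c) (hd : SmoothFm U d) {x : EuclideanSpace ℝ (Fin n)} (hx : x ∈ U) :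
    extDerivFm (fun y S => c y S + d y S) x = extDerivFm c x + extDerivFm d x := by
  unfold extDerivFm
  rw [← Finset.sum_add_distrib]
  refine Finset.sum_congr rfl fun S _ => ?_
  rw [fderiv_fun_add (hc.differentiableAt hU hx S) (hd.differentiableAt hU hx S)]
  simp [mul_add]

lemma extDerivFm_const_mul (hU : IsOpen U) {c : EuclideanSpace ℝ (Fin n) → Fin n → ℝ}
    (hc : SmoothFm U c) (a : ℝ) {x : EuclideanSpace ℝ (Fin n)} (hx : x ∈ U) :
    extDerivFm (fun y S => a * c y S) x = a * extDerivFm c x := by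
  unfold extDerivFm
  rw [Finset.mul_sum]
  refine Finset.sum_congr rfl fun S _ => ?_
  rw [fderiv_const_mul (hc.differentiableAt hU hx S)]
  simp only [smul_apply, smul_eq_mul]
  ring

lemma HasPath.add (hU : IsOpen U) {c d : EuclideanSpace ℝ (Fin n) → Fin n → ℝ} {K L : ℝ}
    (hc : HasPath U θ c K) (hd : HasPath U θ d L) :
    HasPath U θ (fun x S => c x S + d x S) (K + L) := by
  obtain ⟨u, u', h1, h2, ⟨e, he, h3⟩, h4, h5⟩ := hc
  obtain ⟨v, v', k1, k2, ⟨f, hf, k3⟩, k4, k5⟩ := hd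
  refine ⟨fun t x S => u t x S + v t x S, fun t x S => u' t x S + v' t x S,
    fun t ht S => (h1 t ht S).add (k1 t ht S), fun x S t ht => (h2 x S t ht).add (k2 x S t ht),
    ⟨fun t => e t + f t, by simpa using he.add hf, fun t ht x hx S => ?_⟩,
    fun t ht x hx => ?_, fun t ht x hx S => ?_⟩
  · refine le_trans (le_of_eq ?_) ((abs_add_le _ _).trans
      (add_le_add (h3 t ht x hx S) (k3 t ht x hx S)))
    congr 1; ring
  · rw [extDerivFm_add hU (h1 t ht) (k1 t ht) hx]
    refine le_trans ?_ (add_le_add (h4 t ht x hx) (k4 t ht x hx))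
    rw [← mul_add]
    exact mul_le_mul_of_nonneg_left (abs_add_le _ _) (Real.rpow_nonneg (le_of_lt ht) _)
  · refine le_trans ?_ (add_le_add (h5 t ht x hx S) (k5 t ht x hx S))
    rw [← mul_add]
    exact mul_le_mul_of_nonneg_left (abs_add_le _ _) (Real.rpow_nonneg (le_of_lt ht) _)

lemma HasPath.const_mul (hU : IsOpen U) {c : EuclideanSpace ℝ (Fin n) → Fin n → ℝ} {K : ℝ}
    (hc : HasPath U θ c K) (a : ℝ) : HasPath U θ (fun x S => a * c x S) (|a| * K) := by
  obtain ⟨u, u', h1, h2, ⟨e, he, h3⟩, h4, h5⟩ := hc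
  refine ⟨fun t x S => a * u t x S, fun t x S => a * u' t x S,
    fun t ht S => contDiffOn_const.mul (h1 t ht S), fun x S t ht => (h2 x S t ht).const_mul a,
    ⟨fun t => |a| * e t, by simpa using he.const_mul |a|, fun t ht x hx S => ?_⟩,
    fun t ht x hx => ?_, fun t ht x hx S => ?_⟩
  · rw [← mul_sub, abs_mul]
    exact mul_le_mul_of_nonneg_left (h3 t ht x hx S) (abs_nonneg _)
  · rw [extDerivFm_const_mul hU (h1 t ht) a hx, abs_mul, mul_left_comm]
    exact mul_le_mul_of_nonneg_left (h4 t ht x hx) (abs_nonneg _)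
  · rw [abs_mul, mul_left_comm]
    exact mul_le_mul_of_nonneg_left (h5 t ht x hx S) (abs_nonneg _)

lemma HasPath.congr {c d : EuclideanSpace ℝ (Fin n) → Fin n → ℝ} {K : ℝ}
    (hc : HasPath U θ c K) (h : ∀ x ∈ U, ∀ S, c x S = d x S) : HasPath U θ d K := by
  obtain ⟨u, u', h1, h2, ⟨e, he, h3⟩, h4, h5⟩ := hc
  exact ⟨u, u', h1, h2, ⟨e, he, fun t ht x hx S => h x hx S ▸ h3 t ht x hx S⟩, h4, h5⟩

lemma HasPath.mono {c : EuclideanSpace ℝ (Fin n) → Fin n → ℝ} {K L : ℝ}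
    (hc : HasPath U θ c K) (h : K ≤ L) : HasPath U θ c L := by
  obtain ⟨u, u', h1, h2, h3, h4, h5⟩ := hc
  exact ⟨u, u', h1, h2, h3, fun t ht x hx => (h4 t ht x hx).trans h,
    fun t ht x hx S => (h5 t ht x hx S).trans h⟩

lemma HasPath.zero : HasPath U θ (fun _ _ => 0) 0 :=
  ⟨fun _ _ _ => 0, fun _ _ _ => 0, fun _ _ _ => contDiffOn_const,
    fun _ _ t _ => hasDerivAt_const t 0, ⟨fun _ => 0, tendsto_const_nhds, by simp⟩,
    by simp [extDerivFm], by simp⟩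

lemma HasPath.sum (hU : IsOpen U) {ι : Type*} (s : Finset ι)
    {c : ι → EuclideanSpace ℝ (Fin n) → Fin n → ℝ} {K : ι → ℝ}
    (hc : ∀ i ∈ s, HasPath U θ (c i) (K i)) :
    HasPath U θ (fun x S => ∑ i ∈ s, c i x S) (∑ i ∈ s, K i) := by
  induction s using Finset.induction_on with
  | empty => simpa using HasPath.zero
  | insert a s ha ih =>
    simp only [Finset.sum_insert ha]
    exact (hc a (Finset.mem_insert_self a s)).add hU
      (ih fun i hi => hc i (Finset.mem_insert_of_mem hi))

lemma X0norm_le_eSupFm (c : EuclideanSpace ℝ (Fin n) → Fin n → ℝ) :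
    X0norm U c ≤ eSupFm U c := by
  refine iInf₂_le_of_le (fun _ _ => 0) ⟨fun _ => contDiffOn_const, by simp [extDerivFm]⟩ ?_
  exact le_of_eq (congrArg _ (by funext x S; simp))

lemma eSupFm_le {c : EuclideanSpace ℝ (Fin n) → Fin n → ℝ} {K : ℝ}
    (h : ∀ x ∈ U, ∀ S, |c x S| ≤ K) : eSupFm U c ≤ ENNReal.ofReal K :=
  iSup₂_le fun x hx => iSup_le fun S => ENNReal.ofReal_le_ofReal (h x hx S)

lemma HasPath.XthetaNorm_le {c : EuclideanSpace ℝ (Fin n) → Fin n → ℝ} {K : ℝ}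
    (hc : HasPath U θ c K) : XthetaNorm U θ c ≤ ENNReal.ofReal K + ENNReal.ofReal K := by
  obtain ⟨u, u', h1, h2, ⟨e, he, h3⟩, h4, h5⟩ := hc
  have hdiv : ∀ t > (0 : ℝ), ∀ a, t ^ (1 - θ) * a ≤ K → a ≤ K / t ^ (1 - θ) := fun t ht a h => by
    rw [le_div_iff₀ (Real.rpow_pos_of_pos ht _)]; linarith
  have hmul : ∀ t > (0 : ℝ), ENNReal.ofReal (t ^ (1 - θ)) * ENNReal.ofReal (K / t ^ (1 - θ)) =
      ENNReal.ofReal K := fun t ht => by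
    rw [← ENNReal.ofReal_mul (Real.rpow_nonneg (le_of_lt ht) _),
      mul_div_cancel₀ _ (Real.rpow_pos_of_pos ht _).ne']
  refine iInf_le_of_le u (iInf_le_of_le u' (iInf_le_of_le ⟨h1, h2, ?_⟩ (add_le_add ?_ ?_)))
  · have he' : Tendsto (fun t => ENNReal.ofReal (e t)) (𝓝[>] 0) (𝓝 0) := by
      simpa [Function.comp_def] using (ENNReal.continuous_ofReal.tendsto 0).comp he
    refine tendsto_of_tendsto_of_tendsto_of_le_of_le' tendsto_const_nhds he'
      (Eventually.of_forall fun t => zero_le) ?_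
    filter_upwards [self_mem_nhdsWithin] with t ht
    exact (X0norm_le_eSupFm _).trans (eSupFm_le fun x hx S => h3 t ht x hx S)
  · refine iSup₂_le fun t ht => ?_
    rw [← hmul t ht]
    refine mul_le_mul_right ?_ _
    exact iSup₂_le fun x hx => ENNReal.ofReal_le_ofReal (hdiv t ht _ (h4 t ht x hx))
  · refine iSup₂_le fun t ht => ?_
    rw [← hmul t ht]
    refine mul_le_mul_right ?_ _
    exact (X0norm_le_eSupFm _).trans (eSupFm_le fun x hx S => hdiv t ht _ (h5 t ht x hx S))

end Paths

section Smoothing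

variable {n : ℕ} {U : Set (EuclideanSpace ℝ (Fin n))} {θ : ℝ}

/-- The standard basis of `ℝⁿ`. -/
def stdDir (n : ℕ) (k : Fin n) : EuclideanSpace ℝ (Fin n) := EuclideanSpace.single k 1

/-- `f` is the value at time zero of a smooth function on `ℝ × U` whose first derivatives at
time `t` are bounded by `N * w t`. -/
def HasSmoothing (U : Set (EuclideanSpace ℝ (Fin n))) (f : EuclideanSpace ℝ (Fin n) → ℝ)
    (w : ℝ → ℝ) (N : ℝ) : Prop :=
  ∃ H : ℝ × EuclideanSpace ℝ (Fin n) → ℝ, ContDiffOn ℝ (⊤ : ℕ∞) H (univ ×ˢ U) ∧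
    (∀ x ∈ U, H (0, x) = f x) ∧
    ∀ t > 0, ∀ x ∈ U, |fderiv ℝ H (t, x) (1, 0)| ≤ N * w t ∧
      ∀ k, |fderiv ℝ H (t, x) (0, stdDir n k)| ≤ N * w t

/-- The coefficients of the form `h₀ dh₁ ∧ ⋯ ∧ dhₙ₋₁`, where `h₀` is `h i₀`. -/
def jacForm (h : Fin n → EuclideanSpace ℝ (Fin n) → ℝ) (i₀ : Fin n)
    (x : EuclideanSpace ℝ (Fin n)) (S : Fin n) : ℝ :=
  (-1 : ℝ) ^ (S : ℕ) *
    (h i₀ x * rowDet n (Function.update (jac (stdDir n) h x) i₀ (Pi.single S 1)))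

lemma fderiv_comp_prodMk_right {E : Type*} [NormedAddCommGroup E] [NormedSpace ℝ E]
    {H : ℝ × E → ℝ} {t : ℝ} {x : E} (hH : DifferentiableAt ℝ H (t, x)) (v : E) :
    fderiv ℝ (fun y => H (t, y)) x v = fderiv ℝ H (t, x) (0, v) := by
  have := (hH.hasFDerivAt.comp x (hasFDerivAt_prodMk_right t x)).fderiv
  change fderiv ℝ (fun y => H (t, y)) x = _ at this
  rw [this]; simp

lemma hasDerivAt_comp_prodMk_left {E : Type*} [NormedAddCommGroup E] [NormedSpace ℝ E]
    {H : ℝ × E → ℝ} {t : ℝ} {x : E} (hH : DifferentiableAt ℝ H (t, x)) :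
    HasDerivAt (fun s => H (s, x)) (fderiv ℝ H (t, x) (1, 0)) t := by
  have h1 : HasDerivAt (fun s : ℝ => (s, x)) ((1 : ℝ), (0 : E)) t :=
    (hasDerivAt_id t).prodMk (hasDerivAt_const t x)
  exact hH.hasFDerivAt.comp_hasDerivAt t h1

lemma extDerivFm_sign (c : EuclideanSpace ℝ (Fin n) → Fin n → ℝ) {x : EuclideanSpace ℝ (Fin n)}
    (hc : ∀ S, DifferentiableAt ℝ (fun y => c y S) x) :
    extDerivFm (fun y S => (-1 : ℝ) ^ (S : ℕ) * c y S) x =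
      ∑ S, fderiv ℝ (fun y => c y S) x (stdDir n S) := by
  unfold extDerivFm
  refine Finset.sum_congr rfl fun S _ => ?_
  rw [fderiv_const_mul (hc S)]
  simp only [smul_apply, smul_eq_mul, stdDir]
  rw [← mul_assoc, ← mul_pow]
  simp

/-- The form `h₀ dh₁ ∧ ⋯ ∧ dhₙ₋₁` is estimated by smoothing all the functions `h j`. -/
theorem hasPath_jacForm (hU : IsOpen U) (hθ : 0 < θ)
    {h : Fin n → EuclideanSpace ℝ (Fin n) → ℝ} {w : Fin n → ℝ → ℝ} {N : Fin n → ℝ}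
    (hh : ∀ j, HasSmoothing U (h j) (w j) (N j)) (hN : ∀ j, 0 ≤ N j)
    (hw : ∀ t > 0, ∏ j, w j t ≤ t ^ (θ - 1)) (i₀ : Fin n) :
    HasPath U θ (jacForm h i₀) (n * (n.factorial * ∏ j, N j)) := by
  choose H hH hH0 hHb using hh
  set d : Fin n → ℝ × EuclideanSpace ℝ (Fin n) := fun k => (0, stdDir n k) with hd
  set v : ℝ × EuclideanSpace ℝ (Fin n) := (1, 0) with hv
  have hW : IsOpen ((univ : Set ℝ) ×ˢ U) := isOpen_univ.prod hU
  have hWm : ∀ {x}, x ∈ U → ∀ t : ℝ, (t, x) ∈ (univ : Set ℝ) ×ˢ U :=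
    fun hx t => ⟨mem_univ _, hx⟩
  set C : Fin n → ℝ × EuclideanSpace ℝ (Fin n) → ℝ := fun S p => H i₀ p *
    rowDet n (Function.update (jac d H p) i₀ (Pi.single S 1)) with hC
  have hCs : ∀ S, ContDiffOn ℝ (⊤ : ℕ∞) (C S) (univ ×ˢ U) := fun S =>
    contDiffOn_mul_rowDet_update hW hH (hH i₀) i₀ S
  have hρs : ∀ S, ContDiffOn ℝ (⊤ : ℕ∞) (jacFlux d H v S) (univ ×ˢ U) := fun S =>
    contDiffOn_jacFlux hW hH v S
  have hdiff : ∀ {g : ℝ × EuclideanSpace ℝ (Fin n) → ℝ}, ContDiffOn ℝ (⊤ : ℕ∞) g (univ ×ˢ U) →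
      ∀ {x}, x ∈ U → ∀ t, DifferentiableAt ℝ g (t, x) := fun hg x hx t =>
    (hg.contDiffAt (hW.mem_nhds (hWm hx t))).differentiableAt (by simp)
  have hρc : ∀ {x}, x ∈ U → ∀ S, Continuous fun τ : ℝ => jacFlux d H v S (τ, x) :=
    fun hx S => (hρs S).continuousOn.comp_continuous (by fun_prop) fun τ => hWm hx τ
  set K : ℝ := n.factorial * ∏ j, N j with hK
  have hK0 : 0 ≤ K := mul_nonneg (by positivity) (Finset.prod_nonneg fun j _ => hN j)
  have hn1 : (1 : ℝ) ≤ n := by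
    exact_mod_cast Nat.one_le_iff_ne_zero.2 (fun h0 => by subst h0; exact i₀.elim0)
  have hprod : ∀ t > 0, (n.factorial : ℝ) * ∏ j, (N j * w j t) ≤ K * t ^ (θ - 1) := by
    intro t ht
    rw [Finset.prod_mul_distrib, hK, mul_assoc]
    have := Finset.prod_nonneg fun j (_ : j ∈ (Finset.univ : Finset (Fin n))) => hN j
    gcongr
    exact hw t ht
  have hdetb : ∀ t > 0, ∀ x ∈ U, |rowDet n (jac d H (t, x))| ≤ K * t ^ (θ - 1) :=
    fun t ht x hx => (abs_rowDet_le _ (fun j => N j * w j t)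
      fun j k => (hHb j t ht x hx).2 k).trans (hprod t ht)
  have hρb : ∀ t > 0, ∀ x ∈ U, ∀ S, |jacFlux d H v S (t, x)| ≤ n * K * t ^ (θ - 1) := by
    intro t ht x hx S
    unfold jacFlux
    refine (Finset.abs_sum_le_sum_abs _ _).trans ?_
    refine (Finset.sum_le_card_nsmul _ _ (K * t ^ (θ - 1)) fun b _ => ?_).trans
      (le_of_eq (by simp [mul_assoc]))
    have h1 : fderiv ℝ (H b) (t, x) v * rowDet n (Function.update (jac d H (t, x)) b
        (Pi.single S 1)) = rowDet n (Function.update (jac d H (t, x)) b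
          (fderiv ℝ (H b) (t, x) v • Pi.single S 1)) :=
      ((rowDet n).toMultilinearMap.map_update_smul _ b _ _).symm
    rw [h1]
    refine (abs_rowDet_le _ (fun j => N j * w j t) fun j k => ?_).trans (hprod t ht)
    by_cases hj : j = b
    · subst hj
      have h2 := (hHb j t ht x hx).1
      by_cases hk : k = S
      · subst hk; simpa using h2
      · simpa [hk] using (abs_nonneg _).trans h2
    · rw [Function.update_of_ne hj]
      exact (hHb j t ht x hx).2 k
  have hone : ∀ t > (0 : ℝ), t ^ (1 - θ) * t ^ (θ - 1) = 1 := fun t ht => by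
    rw [← Real.rpow_add ht]; simp
  have hscale : ∀ t > (0 : ℝ), ∀ a L : ℝ, a ≤ L * t ^ (θ - 1) → t ^ (1 - θ) * a ≤ L := by
    intro t ht a L ha
    calc t ^ (1 - θ) * a ≤ t ^ (1 - θ) * (L * t ^ (θ - 1)) :=
          mul_le_mul_of_nonneg_left ha (Real.rpow_nonneg (le_of_lt ht) _)
      _ = L * (t ^ (1 - θ) * t ^ (θ - 1)) := by ring
      _ = L := by rw [hone t ht, mul_one]
  set V : ℝ → EuclideanSpace ℝ (Fin n) → Fin n → ℝ := fun t x S =>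
    C S (0, x) + ∫ τ in (0 : ℝ)..t, jacFlux d H v S (τ, x) with hVdef
  have hVs : ∀ t S, ContDiffOn ℝ (⊤ : ℕ∞) (fun x => V t x S) U := fun t S =>
    ((hCs S).comp (g := C S) (f := fun x => ((0 : ℝ), x)) (by fun_prop)
      fun x hx => hWm hx 0).add (contDiffOn_intervalIntegral hU t (hρs S))
  refine ⟨fun t x S => if x ∈ U then (-1 : ℝ) ^ (S : ℕ) * V t x S else 0,
    fun t x S => if x ∈ U then (-1 : ℝ) ^ (S : ℕ) * jacFlux d H v S (t, x) else 0,
    ?_, ?_, ⟨fun t => n * K * (t ^ θ / θ), ?_, ?_⟩, ?_, ?_⟩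
  · intro t _ S
    exact ((contDiffOn_const (c := (-1 : ℝ) ^ (S : ℕ))).mul (hVs t S)).congr fun x hx => by simp [hx]
  · intro x S t _
    by_cases hx : x ∈ U
    · simp only [hx, if_true]
      refine HasDerivAt.const_mul _ (HasDerivAt.const_add _ ?_)
      exact intervalIntegral.integral_hasDerivAt_right ((hρc hx S).intervalIntegrable _ _)
        (hρc hx S).stronglyMeasurable.stronglyMeasurableAtFilter (hρc hx S).continuousAt
    · simp only [hx, if_false]
      exact hasDerivAt_const t 0
  · have h1 : Continuous fun t : ℝ => (n : ℝ) * K * (t ^ θ / θ) :=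
      continuous_const.mul ((Real.continuous_rpow_const hθ.le).div_const _)
    have h2 := (h1.tendsto 0).mono_left (nhdsWithin_le_nhds (s := Ioi 0))
    simpa [Real.zero_rpow hθ.ne'] using h2
  · intro t ht x hx S
    have hc : jacForm h i₀ x S = (-1 : ℝ) ^ (S : ℕ) * C S (0, x) := by
      unfold jacForm
      simp only [hC]
      rw [hH0 i₀ x hx]
      congr 4
      funext j k
      simp only [jac, hd]
      rw [← fderiv_comp_prodMk_right (hdiff (hH j) hx 0)]
      congr 1
      refine Filter.EventuallyEq.fderiv_eq ?_
      filter_upwards [hU.mem_nhds hx] with y hy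
      exact (hH0 j y hy).symm
    simp only [hx, if_true]
    rw [hc, ← mul_sub, abs_mul, abs_pow, abs_neg, abs_one, one_pow, one_mul, hVdef]
    simp only [add_sub_cancel_left]
    have h_int : IntervalIntegrable (fun τ : ℝ => n * K * τ ^ (θ - 1)) volume 0 t :=
      (intervalIntegral.intervalIntegrable_rpow' (by linarith)).const_mul _
    have := intervalIntegral.norm_integral_le_of_norm_le
      (f := fun τ => jacFlux d H v S (τ, x)) (le_of_lt ht)
      (Eventually.of_forall fun τ hτ => (Real.norm_eq_abs _).le.trans (hρb τ hτ.1 x hx S)) h_int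
    rw [Real.norm_eq_abs] at this
    refine this.trans (le_of_eq ?_)
    rw [intervalIntegral.integral_const_mul, integral_rpow (Or.inl (by linarith))]
    simp [Real.zero_rpow hθ.ne']
  · intro t ht x hx
    have hext : extDerivFm (fun x S => if x ∈ U then (-1 : ℝ) ^ (S : ℕ) * V t x S else 0) x =
        extDerivFm (fun x S => (-1 : ℝ) ^ (S : ℕ) * V t x S) x := by
      unfold extDerivFm
      refine Finset.sum_congr rfl fun S _ => ?_
      congr 2
      refine Filter.EventuallyEq.fderiv_eq ?_
      filter_upwards [hU.mem_nhds hx] with y hy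
      simp [hy]
    have hVd : ∀ S, fderiv ℝ (fun y => V t y S) x (stdDir n S) =
        fderiv ℝ (C S) (0, x) (d S) +
          ∫ τ in (0 : ℝ)..t, fderiv ℝ (jacFlux d H v S) (τ, x) (d S) := by
      intro S
      have hI := hasFDerivAt_intervalIntegral_of_contDiffOn hU
        ((hρs S).of_le (WithTop.coe_le_coe.2 (le_top (a := (1 : ℕ∞))))) t hx
      have hCd : DifferentiableAt ℝ (fun y => C S (0, y)) x :=
        (hdiff (hCs S) hx 0).comp x (by fun_prop : DifferentiableAt ℝ
          (fun y : EuclideanSpace ℝ (Fin n) => ((0 : ℝ), y)) x)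
      rw [hVdef]
      simp only
      rw [fderiv_fun_add hCd hI.differentiableAt, add_apply, hI.fderiv,
        fderiv_comp_prodMk_right (hdiff (hCs S) hx 0)]
      congr 1
      have hcont : Continuous fun τ : ℝ => (fderiv ℝ (jacFlux d H v S) (τ, x)).comp
          (ContinuousLinearMap.inr ℝ ℝ (EuclideanSpace ℝ (Fin n))) :=
        (((hρs S).continuousOn_fderiv_of_isOpen hW (by simp)).comp_continuous (by fun_prop)
          fun τ => hWm hx τ).clm_comp continuous_const
      rw [ContinuousLinearMap.intervalIntegral_apply (hcont.intervalIntegrable _ _)]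
      simp [hd]
    have hGs := contDiffOn_rowDet_jac (d := d) hW hH
    have hdet : extDerivFm (fun x S => (-1 : ℝ) ^ (S : ℕ) * V t x S) x =
        rowDet n (jac d H (t, x)) := by
      rw [extDerivFm_sign _ fun S => ((hVs t S).contDiffAt (hU.mem_nhds hx)).differentiableAt
        (by simp)]
      simp_rw [hVd]
      have hcont : ∀ S, Continuous fun τ : ℝ => fderiv ℝ (jacFlux d H v S) (τ, x) (d S) :=
        fun S => ((contDiffOn_fderiv_apply hW (hρs S) (d S)).continuousOn.comp_continuous
          (by fun_prop) fun τ => hWm hx τ)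
      rw [Finset.sum_add_distrib,
        ← intervalIntegral.integral_finsetSum fun S _ => (hcont S).intervalIntegrable _ _]
      have h1 : ∀ τ : ℝ, ∑ S, fderiv ℝ (jacFlux d H v S) (τ, x) (d S) =
          fderiv ℝ (fun q => rowDet n (jac d H q)) (τ, x) v := fun τ =>
        sum_fderiv_jacFlux hW hH v (hWm hx τ)
      simp_rw [h1]
      have h2 : ∑ S, fderiv ℝ (C S) (0, x) (d S) = rowDet n (jac d H (0, x)) := by
        rw [hC]
        rw [sum_fderiv_mul_rowDet_update (fun j => ((hH j).contDiffAt
          (hW.mem_nhds (hWm hx 0))).of_le (WithTop.coe_le_coe.2 (le_top (a := (2 : ℕ∞)))))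
          (hdiff (hH i₀) hx 0)]
        congr 1
        exact Function.update_eq_self i₀ _
      have h3 : ∀ τ ∈ uIcc 0 t, HasDerivAt (fun s => rowDet n (jac d H (s, x)))
          (fderiv ℝ (fun q => rowDet n (jac d H q)) (τ, x) v) τ := fun τ _ =>
        hasDerivAt_comp_prodMk_left (H := fun q => rowDet n (jac d H q)) (hdiff hGs hx τ)
      have hcont' : Continuous fun τ : ℝ => fderiv ℝ (fun q => rowDet n (jac d H q)) (τ, x) v :=
        (contDiffOn_fderiv_apply hW hGs v).continuousOn.comp_continuous
          (by fun_prop) fun τ => hWm hx τ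
      rw [intervalIntegral.integral_eq_sub_of_hasDerivAt h3 (hcont'.intervalIntegrable _ _), h2]
      ring
    rw [hext, hdet]
    refine (hscale t ht _ _ (hdetb t ht x hx)).trans ?_
    nlinarith
  · intro t ht x hx S
    simp only [hx, if_true]
    rw [abs_mul, abs_pow, abs_neg, abs_one, one_pow, one_mul]
    exact hscale t ht _ _ (hρb t ht x hx S)

end Smoothing

section HolderExtension

/-- McShane extension of Hölder functions. -/
lemma exists_holder_extension {X : Type*} [PseudoMetricSpace X] {f : X → ℝ} {s : Set X} {β N : ℝ}
    (hβ : 0 < β) (hβ1 : β ≤ 1) (hN : 0 ≤ N)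
    (hf : ∀ x ∈ s, ∀ y ∈ s, |f x - f y| ≤ N * dist x y ^ β) :
    ∃ g : X → ℝ, (∀ x y, |g x - g y| ≤ N * dist x y ^ β) ∧ EqOn f g s := by
  let Y := Metric.Snowflaking X β hβ hβ1
  let φ : X ≃ Y := Metric.Snowflaking.toSnowflaking
  lift N to NNReal using hN
  have hL : LipschitzOnWith N (f ∘ φ.symm) (φ '' s) := by
    refine LipschitzOnWith.of_dist_le_mul ?_
    rintro _ ⟨x, hx, rfl⟩ _ ⟨y, hy, rfl⟩
    simp only [Function.comp, Equiv.symm_apply_apply, φ]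
    exact hf x hx y hy
  obtain ⟨g, hg, hfg⟩ := hL.extend_real
  refine ⟨g ∘ φ, fun x y => ?_, fun x hx => ?_⟩
  · have := hg.dist_le_mul (φ x) (φ y)
    rwa [Metric.Snowflaking.dist_toSnowflaking_toSnowflaking] at this
  · simpa using hfg (mem_image_of_mem φ hx)

lemma continuous_of_holder {X : Type*} [PseudoMetricSpace X] {f : X → ℝ} {β N : ℝ}
    (hβ : 0 < β) (hf : ∀ x y, |f x - f y| ≤ N * dist x y ^ β) : Continuous f := by
  rw [continuous_iff_continuousAt]
  intro x
  rw [ContinuousAt, tendsto_iff_dist_tendsto_zero]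
  have h1 : Continuous fun y => N * dist y x ^ β :=
    continuous_const.mul ((continuous_id.dist continuous_const).rpow_const fun _ => Or.inr hβ.le)
  have h2 := h1.tendsto x
  simp only [dist_self, Real.zero_rpow hβ.ne', mul_zero] at h2
  exact squeeze_zero (fun _ => dist_nonneg) (fun y => hf y x) h2

end HolderExtension

section Mollify

variable {E : Type} [NormedAddCommGroup E] [InnerProductSpace ℝ E] [FiniteDimensional ℝ E]
  [MeasurableSpace E] [BorelSpace E]

/-- A smooth probability density supported in the unit ball. -/
def mollifier (E : Type) [NormedAddCommGroup E] [InnerProductSpace ℝ E] [FiniteDimensional ℝ E]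
    [MeasurableSpace E] [BorelSpace E] : E → ℝ :=
  ContDiffBump.normed (⟨1 / 2, 1, by norm_num, by norm_num⟩ : ContDiffBump (0 : E)) volume

lemma contDiff_mollifier : ContDiff ℝ (⊤ : ℕ∞) (mollifier E) := ContDiffBump.contDiff_normed _

lemma mollifier_nonneg (y : E) : 0 ≤ mollifier E y := ContDiffBump.nonneg_normed _ _

lemma integral_mollifier : ∫ y, mollifier E y = 1 := ContDiffBump.integral_normed _

lemma mollifier_eq_zero {y : E} (hy : 1 ≤ ‖y‖) : mollifier E y = 0 := by
  rw [← Function.notMem_support, mollifier, ContDiffBump.support_normed_eq]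
  simpa using hy

lemma integrable_mul_mollifier {g : E → ℝ} (hg : Continuous g) :
    Integrable fun y => g y * mollifier E y :=
  (hg.mul contDiff_mollifier.continuous).integrable_of_hasCompactSupport
    (ContDiffBump.hasCompactSupport_normed _).mul_left

/-- Convolution of `f` with the mollifier at scale `p.1`, evaluated at `p.2`. -/
def mollify (f : E → ℝ) (p : ℝ × E) : ℝ := ∫ y, f (p.2 - p.1 • y) * mollifier E y

/-- The mollifier rescaled to scale `p.1`. -/
def mollKernel (E : Type) [NormedAddCommGroup E] [InnerProductSpace ℝ E] [FiniteDimensional ℝ E]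
    [MeasurableSpace E] [BorelSpace E] (p : ℝ × E) : ℝ :=
  |(p.1 ^ Module.finrank ℝ E)⁻¹| * mollifier E (p.1⁻¹ • p.2)

lemma mollify_eq (f : E → ℝ) {p : ℝ × E} (hp : p.1 ≠ 0) :
    mollify f p = ∫ z, f z * mollKernel E (p.1, p.2 - z) := by
  have h1 := Measure.integral_comp_smul (volume : Measure E)
    (fun u => f (p.2 - u) * mollifier E (p.1⁻¹ • u)) p.1
  simp only [smul_smul, inv_mul_cancel₀ hp, one_smul] at h1
  rw [mollify, h1, ← integral_sub_left_eq_self _ volume p.2, smul_eq_mul, ← integral_const_mul]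
  refine integral_congr_ae (Eventually.of_forall fun z => ?_)
  simp only [_root_.sub_sub_cancel, mollKernel]
  ring

lemma contDiffAt_mollKernel {p : ℝ × E} (hp : p.1 ≠ 0) :
    ContDiffAt ℝ (⊤ : ℕ∞) (mollKernel E) p := by
  have h0 : ContDiffAt ℝ (⊤ : ℕ∞) (fun q : ℝ × E => q.1) p := contDiffAt_fst
  refine ContDiffAt.mul ?_ ?_
  · exact (contDiffAt_abs (inv_ne_zero (pow_ne_zero _ hp))).comp p
      ((h0.pow _).inv (pow_ne_zero _ hp))
  · exact contDiff_mollifier.contDiffAt.comp p ((h0.inv hp).smul contDiffAt_snd)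

lemma mollKernel_eq_zero {t : ℝ} {v : E} (ht : t ≠ 0) (h : |t| ≤ ‖v‖) :
    mollKernel E (t, v) = 0 := by
  rw [mollKernel, mollifier_eq_zero, mul_zero]
  rw [norm_smul, norm_inv, Real.norm_eq_abs]
  rw [← div_eq_inv_mul, one_le_div (abs_pos.2 ht)]
  exact h

lemma contDiffOn_mollify_ne_zero {f : E → ℝ} (hf : Continuous f) {p : ℝ × E} (hp : p.1 ≠ 0) :
    ContDiffAt ℝ (⊤ : ℕ∞) (mollify f) p := by
  set s : Set ℝ := {t | t ≠ 0 ∧ |t| < |p.1| + 1} with hs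
  have hso : IsOpen s := (isOpen_ne).inter (isOpen_lt continuous_abs continuous_const)
  have hps : p.1 ∈ s := ⟨hp, by linarith⟩
  have key := contDiffOn_convolution_right_with_param (μ := (volume : Measure E)) (f := f)
    (n := ⊤) (ContinuousLinearMap.mul ℝ ℝ) (g := fun t v => mollKernel E (t, v)) hso
    (isCompact_closedBall (0 : E) (|p.1| + 1)) ?_ hf.locallyIntegrable ?_
  · refine (key.contDiffAt ((hso.prod isOpen_univ).mem_nhds ⟨hps, mem_univ _⟩)).congr_of_eventuallyEq ?_
    filter_upwards [(isOpen_ne.preimage continuous_fst).mem_nhds hp] with q hq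
    rw [mollify_eq f hq]
    rfl
  · intro t v ht hv
    refine mollKernel_eq_zero ht.1 (ht.2.le.trans ?_)
    simpa using (not_le.1 fun h => hv (by simpa using h)).le
  · intro q hq
    exact (contDiffAt_mollKernel hq.1.1).contDiffWithinAt

lemma contDiffAt_mollify_zero {f : E → ℝ} {x : E}
    (hf : ∀ᶠ y in 𝓝 x, ContDiffAt ℝ (⊤ : ℕ∞) f y) :
    ContDiffAt ℝ (⊤ : ℕ∞) (mollify f) (0, x) := by
  obtain ⟨r, hr, hrf⟩ := Metric.eventually_nhds_iff_ball.1 hf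
  let ψ : ContDiffBump x := ⟨r / 4, r / 2, by positivity, by linarith⟩
  set g : E → ℝ := fun y => ψ y * f y with hg
  have hgs : ContDiff ℝ (⊤ : ℕ∞) g := by
    rw [contDiff_iff_contDiffAt]
    intro y
    by_cases hy : dist y x < r
    · exact ψ.contDiffAt.mul (hrf y hy)
    · have : g =ᶠ[𝓝 y] fun _ => 0 := by
        filter_upwards [(isOpen_lt continuous_const (by fun_prop : Continuous fun z => dist z x)).mem_nhds
          (show r / 2 < dist y x by linarith)] with z hz
        simp only [hg]
        rw [ψ.zero_of_le_dist (le_of_lt hz), zero_mul]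
      exact contDiffAt_const.congr_of_eventuallyEq this
  have key := contDiffOn_convolution_right_with_param (μ := (volume : Measure E))
    (f := fun _ : E => (1 : ℝ)) (n := ⊤) (ContinuousLinearMap.mul ℝ ℝ)
    (g := fun (p : ℝ × E) v => g (p.2 + p.1 • v) * mollifier E (-v)) isOpen_univ
    (isCompact_closedBall (0 : E) 1) ?_ continuous_const.locallyIntegrable ?_
  · have h1 : ContDiffAt ℝ (⊤ : ℕ∞) (fun p : ℝ × E => ((p, 0) : (ℝ × E) × E)) (0, x) := by fun_prop
    refine (ContDiffAt.comp (0, x) (key.contDiffAt ((isOpen_univ.prod isOpen_univ).mem_nhds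
      ⟨mem_univ _, mem_univ _⟩)) h1).congr_of_eventuallyEq ?_
    have h2 : Metric.ball (0 : ℝ) (r / 8) ×ˢ Metric.ball x (r / 8) ∈ 𝓝 ((0 : ℝ), x) :=
      prod_mem_nhds (Metric.ball_mem_nhds _ (by positivity))
        (Metric.ball_mem_nhds _ (by positivity))
    filter_upwards [h2] with q hq
    simp only [Function.comp, convolution, mollify]
    refine integral_congr_ae (Eventually.of_forall fun y => ?_)
    simp only [zero_sub, smul_neg, neg_neg, ContinuousLinearMap.mul_apply', one_mul, hg,
      ← sub_eq_add_neg]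
    by_cases hy : 1 ≤ ‖y‖
    · simp [mollifier_eq_zero hy]
    · rw [ψ.one_of_mem_closedBall, one_mul]
      have h3 : |q.1| < r / 8 := by simpa using hq.1
      have h4 : dist q.2 x < r / 8 := hq.2
      rw [Metric.mem_closedBall]
      change dist _ x ≤ r / 4
      have h5 : dist (q.2 - q.1 • y) q.2 ≤ |q.1| := by
        rw [dist_eq_norm, sub_sub_cancel_left, norm_neg, norm_smul, Real.norm_eq_abs]
        exact mul_le_of_le_one_right (abs_nonneg _) (not_le.1 hy).le
      linarith [dist_triangle (q.2 - q.1 • y) q.2 x]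
  · intro p v _ hv
    rw [mollifier_eq_zero, mul_zero]
    rw [norm_neg]
    exact (not_le.1 fun h => hv (by simpa using h)).le
  · have hm := contDiff_mollifier (E := E)
    refine ContDiff.contDiffOn ?_
    change ContDiff ℝ _ fun z : (ℝ × E) × E => g (z.1.2 + z.1.1 • z.2) * mollifier E (-z.2)
    exact (hgs.comp (by fun_prop)).mul (hm.comp (by fun_prop))

lemma exists_mollKernel_lipschitz :
    ∃ L : ℝ, 0 ≤ L ∧ ∀ t ∈ Icc (1 / 2 : ℝ) 2, ∀ v ∈ Metric.closedBall (0 : E) 4,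
      ∀ v' ∈ Metric.closedBall (0 : E) 4,
      |mollKernel E (t, v) - mollKernel E (1, v')| ≤ L * ‖((t, v) : ℝ × E) - (1, v')‖ := by
  set s : Set (ℝ × E) := Icc (1 / 2 : ℝ) 2 ×ˢ Metric.closedBall (0 : E) 4 with hs
  have hd : ∀ p ∈ s, ContDiffAt ℝ (⊤ : ℕ∞) (mollKernel E) p := fun p hp =>
    contDiffAt_mollKernel (by have := hp.1.1; positivity)
  have hc : ContinuousOn (fderiv ℝ (mollKernel E)) s := fun p hp =>
    ((hd p hp).fderiv_right (m := 0) (by simp)).continuousAt.continuousWithinAt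
  have hcomp : IsCompact s := isCompact_Icc.prod (isCompact_closedBall (0 : E) 4)
  obtain ⟨L, hL⟩ := hcomp.exists_bound_of_continuousOn (E := ℝ × E →L[ℝ] ℝ) hc
  refine ⟨max L 0, le_max_right _ _, fun t ht v hv v' hv' => ?_⟩
  have hconv : Convex ℝ s := (convex_Icc _ _).prod (convex_closedBall _ _)
  exact hconv.norm_image_sub_le_of_norm_fderiv_le (𝕜 := ℝ) (fun p hp => (hd p hp).differentiableAt (by simp))
    (fun p hp => (hL p hp).trans (le_max_left _ _)) (x := (1, v')) (y := (t, v))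
    ⟨by norm_num, hv'⟩ ⟨ht, hv⟩

end Mollify

section MollifyBounds

variable {E : Type} [NormedAddCommGroup E] [InnerProductSpace ℝ E] [FiniteDimensional ℝ E]
  [MeasurableSpace E] [BorelSpace E]

lemma integrable_mul_mollKernel {g : E → ℝ} (hg : Continuous g) {t : ℝ} (ht : t ≠ 0) (x : E) :
    Integrable fun z => g z * mollKernel E (t, x - z) := by
  refine Continuous.integrable_of_hasCompactSupport ?_ ?_
  · refine hg.mul ?_
    rw [continuous_iff_continuousAt]
    intro z
    exact ContinuousAt.comp (g := mollKernel E) (f := fun z : E => (t, x - z))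
      (contDiffAt_mollKernel (p := (t, x - z)) ht).continuousAt (by fun_prop)
  · refine HasCompactSupport.intro (isCompact_closedBall x |t|) fun z hz => ?_
    rw [mollKernel_eq_zero ht, mul_zero]
    rw [← dist_eq_norm, dist_comm]
    exact (not_le.1 fun h => hz h).le

variable (E) in
lemma exists_mollify_lipschitz :
    ∃ C : ℝ, 0 ≤ C ∧ ∀ (g : E → ℝ) (M : ℝ), Continuous g → 0 ≤ M → (∀ u, ‖u‖ ≤ 3 → |g u| ≤ M) →
      ∀ t x, |t - 1| < 1 / 2 → ‖x‖ < 1 / 2 →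
        |mollify g (t, x) - mollify g (1, 0)| ≤ C * M * ‖((t, x) : ℝ × E) - (1, 0)‖ := by
  obtain ⟨L, hL0, hL⟩ := exists_mollKernel_lipschitz (E := E)
  refine ⟨L * volume.real (Metric.closedBall (0 : E) 3), by positivity, ?_⟩
  intro g M hg hM hgM t x ht hx
  obtain ⟨ht1, ht2⟩ := abs_lt.1 ht
  have ht0 : t ≠ 0 := by intro h; subst h; norm_num at ht1
  set D := ‖((t, x) : ℝ × E) - (1, 0)‖ with hD
  rw [mollify_eq g (p := (t, x)) ht0, mollify_eq g (p := (1, 0)) one_ne_zero,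
    ← integral_sub (integrable_mul_mollKernel hg ht0 x)
      (integrable_mul_mollKernel hg one_ne_zero 0)]
  rw [← setIntegral_eq_integral_of_forall_compl_eq_zero (s := Metric.closedBall (0 : E) 3)]
  · have := norm_setIntegral_le_of_norm_le_const (μ := volume) (s := Metric.closedBall (0 : E) 3)
      (f := fun z => g z * mollKernel E (t, x - z) - g z * mollKernel E (1, 0 - z))
      (C := M * (L * D)) measure_closedBall_lt_top ?_
    · rw [Real.norm_eq_abs] at this
      exact this.trans (le_of_eq (by ring))
    · intro z hz
      have hz : ‖z‖ ≤ 3 := by simpa using hz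
      rw [← mul_sub, norm_mul, Real.norm_eq_abs, Real.norm_eq_abs]
      refine mul_le_mul (hgM z hz) ?_ (abs_nonneg _) hM
      have h1 := hL t ⟨by linarith, by linarith⟩ (x - z) ?_ (0 - z) ?_
      · refine h1.trans (le_of_eq ?_)
        rw [hD]
        congr 2
        simp
      · rw [mem_closedBall_zero_iff]
        exact (norm_sub_le _ _).trans (by linarith)
      · rw [mem_closedBall_zero_iff, zero_sub, norm_neg]
        linarith
  · intro z hz
    have hz : 3 < ‖z‖ := by simpa using hz
    rw [mollKernel_eq_zero ht0, mollKernel_eq_zero one_ne_zero]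
    · simp
    · rw [zero_sub, norm_neg, abs_one]; linarith
    · have := norm_sub_norm_le z x
      rw [norm_sub_rev, abs_of_pos (by linarith)]
      linarith

lemma mollify_rescale {f : E → ℝ} (hf : Continuous f) {t₀ : ℝ} (ht₀ : t₀ ≠ 0) (x₀ : E) (t : ℝ)
    (x : E) : mollify f (t, x) = f x₀ +
      mollify (fun u => f (x₀ + t₀ • u) - f x₀) (t₀⁻¹ * t, t₀⁻¹ • (x - x₀)) := by
  have h1 : ∀ y : E, x₀ + t₀ • (t₀⁻¹ • (x - x₀) - (t₀⁻¹ * t) • y) = x - t • y := by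
    intro y
    rw [smul_sub, smul_smul, smul_smul, ← mul_assoc, mul_inv_cancel₀ ht₀, one_smul, one_mul]
    abel
  simp only [mollify, h1, sub_mul]
  have hc : Continuous fun y : E => f (x - t • y) := hf.comp (by fun_prop)
  rw [integral_sub (integrable_mul_mollifier hc) (integrable_mul_mollifier continuous_const),
    integral_const_mul, integral_mollifier]
  ring

variable (E) in
lemma exists_fderiv_mollify_le :
    ∃ C : ℝ, 0 ≤ C ∧ ∀ (f : E → ℝ) (β N : ℝ), 0 < β → β ≤ 1 → 0 ≤ N →
      (∀ x y, |f x - f y| ≤ N * dist x y ^ β) → ∀ t > 0, ∀ x,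
        ‖fderiv ℝ (mollify f) (t, x)‖ ≤ C * N * t ^ (β - 1) := by
  obtain ⟨C, hC0, hC⟩ := exists_mollify_lipschitz E
  refine ⟨3 * C, by positivity, ?_⟩
  intro f β N hβ hβ1 hN hf t₀ ht₀ x₀
  have hfc := continuous_of_holder hβ hf
  have hdiff : DifferentiableAt ℝ (mollify f) (t₀, x₀) :=
    (contDiffOn_mollify_ne_zero hfc (p := (t₀, x₀)) ht₀.ne').differentiableAt (by simp)
  refine hdiff.hasFDerivAt.le_of_lip' (by positivity) ?_
  have h1 : Metric.ball t₀ (t₀ / 2) ×ˢ Metric.ball x₀ (t₀ / 2) ∈ 𝓝 (t₀, x₀) :=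
    prod_mem_nhds (Metric.ball_mem_nhds _ (by positivity)) (Metric.ball_mem_nhds _ (by positivity))
  filter_upwards [h1]
  rintro ⟨t, x⟩ ⟨ht, hx⟩
  simp only [Metric.mem_ball, dist_eq_norm] at ht hx
  rw [Real.norm_eq_abs] at ht
  set g : E → ℝ := fun u => f (x₀ + t₀ • u) - f x₀ with hg
  have hgc : Continuous g := (hfc.comp (by fun_prop)).sub continuous_const
  have hgM : ∀ u, ‖u‖ ≤ 3 → |g u| ≤ 3 * N * t₀ ^ β := by
    intro u hu
    refine (hf _ _).trans ?_
    rw [dist_eq_norm, add_sub_cancel_left, norm_smul, Real.norm_eq_abs, abs_of_pos ht₀,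
      Real.mul_rpow ht₀.le (norm_nonneg _)]
    have h3 : ‖u‖ ^ β ≤ 3 := by
      calc ‖u‖ ^ β ≤ 3 ^ β := Real.rpow_le_rpow (norm_nonneg _) hu hβ.le
        _ ≤ 3 ^ (1 : ℝ) := Real.rpow_le_rpow_of_exponent_le (by norm_num) hβ1
        _ = 3 := Real.rpow_one 3
    have h4 : 0 ≤ N * t₀ ^ β := by positivity
    nlinarith
  have key := hC g (3 * N * t₀ ^ β) hgc (by positivity) hgM (t₀⁻¹ * t) (t₀⁻¹ • (x - x₀)) ?_ ?_
  · have hr := mollify_rescale hfc ht₀.ne' x₀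
    rw [hr t x, hr t₀ x₀, add_sub_add_left_eq_sub, sub_self, smul_zero, inv_mul_cancel₀ ht₀.ne',
      Real.norm_eq_abs]
    refine key.trans (le_of_eq ?_)
    have h5 : ((t₀⁻¹ * t, t₀⁻¹ • (x - x₀)) : ℝ × E) - (1, 0) = t₀⁻¹ • ((t, x) - (t₀, x₀)) := by
      ext
      · simp [mul_sub, inv_mul_cancel₀ ht₀.ne']
      · simp
    rw [h5, norm_smul, Real.norm_eq_abs, abs_of_pos (inv_pos.2 ht₀), Real.rpow_sub_one ht₀.ne']
    ring
  · rw [show t₀⁻¹ * t - 1 = t₀⁻¹ * (t - t₀) by field_simp, abs_mul, abs_of_pos (inv_pos.2 ht₀),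
      inv_mul_lt_iff₀ ht₀]
    linarith
  · rw [norm_smul, Real.norm_eq_abs, abs_of_pos (inv_pos.2 ht₀), inv_mul_lt_iff₀ ht₀]
    linarith

lemma abs_mollify_le {f : E → ℝ} {β N : ℝ} (hβ : 0 < β) (hN : 0 ≤ N)
    (hf : ∀ x y, |f x - f y| ≤ N * dist x y ^ β) {t : ℝ} (ht : 0 < t) (ht1 : t ≤ 1) {x : E}
    (hx : |f x| ≤ N) : |mollify f (t, x)| ≤ 2 * N := by
  have hfc := continuous_of_holder hβ hf
  have h1 : ∀ y : E, ‖f (x - t • y) * mollifier E y‖ ≤ 2 * N * mollifier E y := by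
    intro y
    by_cases hy : 1 ≤ ‖y‖
    · simp [mollifier_eq_zero hy]
    · rw [norm_mul, Real.norm_eq_abs, Real.norm_eq_abs, abs_of_nonneg (mollifier_nonneg y)]
      refine mul_le_mul_of_nonneg_right ?_ (mollifier_nonneg y)
      have h2 := hf (x - t • y) x
      have h3 : dist (x - t • y) x ≤ 1 := by
        rw [dist_eq_norm, sub_sub_cancel_left, norm_neg, norm_smul, Real.norm_eq_abs,
          abs_of_pos ht]
        have := norm_nonneg y
        nlinarith [not_le.1 hy]
      have h4 : dist (x - t • y) x ^ β ≤ 1 := Real.rpow_le_one dist_nonneg h3 hβ.le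
      have h5 : N * dist (x - t • y) x ^ β ≤ N := mul_le_of_le_one_right hN h4
      rw [abs_le] at *
      constructor <;> linarith
  have h2 := norm_integral_le_of_norm_le ((ContDiffBump.integrable_normed _).const_mul (2 * N))
    (Eventually.of_forall h1)
  rw [Real.norm_eq_abs] at h2
  refine h2.trans (le_of_eq ?_)
  rw [integral_const_mul]
  change 2 * N * ∫ y, mollifier E y = _
  rw [integral_mollifier, mul_one]

end MollifyBounds

section HolderSmoothing

variable {n : ℕ}

/-- The rate `t ^ (β - 1)`, cut off at time one. -/
def holderRate (β t : ℝ) : ℝ := if t ≤ 1 then t ^ (β - 1) else 0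

lemma hasSmoothing_of_holder (n : ℕ) {β : ℝ} (hβ : 0 < β) (hβ1 : β ≤ 1) :
    ∃ C : ℝ, 0 ≤ C ∧ ∀ (U : Set (EuclideanSpace ℝ (Fin n))) (f : EuclideanSpace ℝ (Fin n) → ℝ)
      (N : ℝ), IsOpen U → 0 ≤ N → ContDiffOn ℝ (⊤ : ℕ∞) f U → (∀ x ∈ U, |f x| ≤ N) →
      (∀ x ∈ U, ∀ y ∈ U, |f x - f y| ≤ N * dist x y ^ β) →
      HasSmoothing U f (holderRate β) (C * N) := by
  obtain ⟨C, hC0, hC⟩ := exists_fderiv_mollify_le (EuclideanSpace ℝ (Fin n))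
  let χ : ContDiffBump (0 : ℝ) := ⟨1 / 2, 1, by norm_num, by norm_num⟩
  have hχs : ContDiff ℝ (⊤ : ℕ∞) (χ : ℝ → ℝ) := χ.contDiff
  obtain ⟨C₁, hC₁⟩ := (isCompact_Icc (a := (0 : ℝ)) (b := 1)).exists_bound_of_continuousOn
    (hχs.continuous_deriv (by simp)).continuousOn
  have hC₁0 : 0 ≤ C₁ := (norm_nonneg _).trans (hC₁ 0 (by simp))
  refine ⟨C + 2 * C₁, by positivity, ?_⟩
  intro U f N hU hN hf hfN hfβ
  obtain ⟨g, hg, hfg⟩ := exists_holder_extension hβ hβ1 hN hfβ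
  have hgc := continuous_of_holder hβ hg
  have hgs : ∀ x ∈ U, ∀ᶠ y in 𝓝 x, ContDiffAt ℝ (⊤ : ℕ∞) g y := by
    intro x hx
    filter_upwards [hU.mem_nhds hx] with y hy
    refine (hf.contDiffAt (hU.mem_nhds hy)).congr_of_eventuallyEq ?_
    filter_upwards [hU.mem_nhds hy] with z hz
    exact (hfg hz).symm
  have hms : ∀ t, ∀ x ∈ U, ContDiffAt ℝ (⊤ : ℕ∞) (mollify g) (t, x) := by
    intro t x hx
    by_cases ht : t = 0
    · subst ht; exact contDiffAt_mollify_zero (hgs x hx)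
    · exact contDiffOn_mollify_ne_zero hgc ht
  refine ⟨fun p => χ p.1 * mollify g p, ?_, ?_, ?_⟩
  · rintro ⟨t, x⟩ hp
    exact ((hχs.comp contDiff_fst).contDiffAt.mul (hms t x hp.2)).contDiffWithinAt
  · intro x hx
    have h1 : χ 0 = 1 := χ.one_of_mem_closedBall (by simp [χ])
    simp only [h1, mollify, zero_smul, sub_zero, one_mul, integral_const_mul, integral_mollifier,
      mul_one]
    exact (hfg hx).symm
  · intro t ht x hx
    have hbound : ∀ v : ℝ × EuclideanSpace ℝ (Fin n), ‖v‖ ≤ 1 →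
        |fderiv ℝ (fun p : ℝ × EuclideanSpace ℝ (Fin n) => χ p.1 * mollify g p) (t, x) v| ≤
          (C + 2 * C₁) * N * holderRate β t := by
      intro v hv
      by_cases ht1 : t ≤ 1
      · have hd1 : HasFDerivAt (fun p : ℝ × EuclideanSpace ℝ (Fin n) => χ p.1)
            (deriv χ t • ContinuousLinearMap.fst ℝ ℝ (EuclideanSpace ℝ (Fin n))) (t, x) :=
          HasDerivAt.comp_hasFDerivAt (h₂ := (χ : ℝ → ℝ)) (t, x)
            ((hχs.differentiable (by simp)) t).hasDerivAt hasFDerivAt_fst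
        have hd2 := ((hms t x hx).differentiableAt (by simp)).hasFDerivAt
        have hd3 : HasFDerivAt (fun p : ℝ × EuclideanSpace ℝ (Fin n) => χ p.1 * mollify g p) _
          (t, x) := hd1.mul hd2
        rw [hd3.fderiv, holderRate, if_pos ht1]
        simp only [add_apply, smul_apply, ContinuousLinearMap.coe_fst', smul_eq_mul]
        have hb1 : |fderiv ℝ (mollify g) (t, x) v| ≤ C * N * t ^ (β - 1) := by
          have h3 := hC g β N hβ hβ1 hN hg t ht x
          have h4 := (fderiv ℝ (mollify g) (t, x)).le_opNorm v
          rw [Real.norm_eq_abs] at h4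
          refine h4.trans ((mul_le_of_le_one_right (norm_nonneg _) hv).trans h3)
        have hb2 : |mollify g (t, x)| ≤ 2 * N :=
          abs_mollify_le hβ hN hg ht ht1 ((hfg hx) ▸ hfN x hx)
        have hb3 : |deriv χ t| ≤ C₁ := hC₁ t ⟨ht.le, ht1⟩
        have hb4 : |χ t| ≤ 1 := by rw [abs_of_nonneg χ.nonneg]; exact χ.le_one
        have hb5 : |v.1| ≤ 1 := (norm_fst_le v).trans hv
        have hb6 : 1 ≤ t ^ (β - 1) := Real.one_le_rpow_of_pos_of_le_one_of_nonpos ht ht1 (by linarith)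
        refine (abs_add_le _ _).trans ?_
        rw [abs_mul, abs_mul, abs_mul]
        have e1 : |χ t| * |fderiv ℝ (mollify g) (t, x) v| ≤ 1 * (C * N * t ^ (β - 1)) :=
          mul_le_mul hb4 hb1 (abs_nonneg _) zero_le_one
        have e2 : |mollify g (t, x)| * (|deriv χ t| * |v.1|) ≤ 2 * N * (C₁ * 1) :=
          mul_le_mul hb2 (mul_le_mul hb3 hb5 (abs_nonneg _) hC₁0) (by positivity) (by positivity)
        have e3 : 2 * N * C₁ ≤ 2 * N * C₁ * t ^ (β - 1) :=
          le_mul_of_one_le_right (by positivity) hb6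
        linarith
      · have h0 : (fun p : ℝ × EuclideanSpace ℝ (Fin n) => χ p.1 * mollify g p) =ᶠ[𝓝 (t, x)]
            fun _ => 0 := by
          filter_upwards [(isOpen_lt continuous_const continuous_fst).mem_nhds
            (show (1 : ℝ) < (t, x).1 from not_le.1 ht1)] with p hp
          rw [χ.zero_of_le_dist, zero_mul]
          rw [Real.dist_eq, sub_zero]
          exact (le_of_lt hp).trans (le_abs_self _)
        rw [h0.fderiv_eq]
        simp [holderRate, ht1]
    refine ⟨hbound _ ?_, fun k => hbound _ ?_⟩
    · simp [Prod.norm_def]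
    · simp [Prod.norm_def, stdDir]

lemma hasSmoothing_const_mul_coord {U : Set (EuclideanSpace ℝ (Fin n))} {a N : ℝ} (h : |a| ≤ N)
    (k : Fin n) : HasSmoothing U (fun x => a * x k) (fun _ => 1) N := by
  have hN : 0 ≤ N := (abs_nonneg a).trans h
  set l : ℝ × EuclideanSpace ℝ (Fin n) →L[ℝ] ℝ := a • ((EuclideanSpace.proj k).comp
    (ContinuousLinearMap.snd ℝ ℝ (EuclideanSpace ℝ (Fin n)))) with hl
  refine ⟨l, l.contDiff.contDiffOn, fun x _ => by simp [hl], fun t _ x _ => ?_⟩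
  rw [l.fderiv]
  refine ⟨by simpa [hl] using hN, fun j => ?_⟩
  by_cases hj : k = j
  · subst hj; simpa [hl, stdDir] using h
  · simpa [hl, stdDir, hj] using hN

end HolderSmoothing

section Multilinear

variable {n : ℕ} {U : Set (EuclideanSpace ℝ (Fin n))} {θ β : ℝ}

lemma HasSmoothing.contDiffOn {f : EuclideanSpace ℝ (Fin n) → ℝ} {w : ℝ → ℝ} {N : ℝ}
    (h : HasSmoothing U f w N) : ContDiffOn ℝ (⊤ : ℕ∞) f U := by
  obtain ⟨H, hH, hH0, -⟩ := h
  refine (hH.comp (g := H) (f := fun x => ((0 : ℝ), x)) (by fun_prop)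
    fun x hx => ⟨mem_univ _, hx⟩).congr fun x hx => (hH0 x hx).symm

lemma HasSmoothing.mono {f : EuclideanSpace ℝ (Fin n) → ℝ} {w : ℝ → ℝ} {N M : ℝ}
    (h : HasSmoothing U f w N) (hw : ∀ t > 0, 0 ≤ w t) (hNM : N ≤ M) : HasSmoothing U f w M := by
  obtain ⟨H, hH, hH0, hb⟩ := h
  refine ⟨H, hH, hH0, fun t ht x hx => ?_⟩
  have := mul_le_mul_of_nonneg_right hNM (hw t ht)
  exact ⟨((hb t ht x hx).1).trans this, fun k => ((hb t ht x hx).2 k).trans this⟩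

lemma jacForm_update_sub {h : Fin n → EuclideanSpace ℝ (Fin n) → ℝ}
    {a b : EuclideanSpace ℝ (Fin n) → ℝ} {x : EuclideanSpace ℝ (Fin n)}
    (ha : DifferentiableAt ℝ a x) (hb : DifferentiableAt ℝ b x) (i₀ j S : Fin n) :
    jacForm (Function.update h j (fun y => a y - b y)) i₀ x S =
      jacForm (Function.update h j a) i₀ x S - jacForm (Function.update h j b) i₀ x S := by
  have hrow : ∀ c : EuclideanSpace ℝ (Fin n) → ℝ, jac (stdDir n) (Function.update h j c) x =
      Function.update (jac (stdDir n) h x) j (fun k => fderiv ℝ c x (stdDir n k)) := by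
    intro c
    funext i k
    by_cases hi : i = j
    · subst hi; simp [jac]
    · simp [jac, hi]
  unfold jacForm
  rw [hrow, hrow, hrow]
  by_cases hj : j = i₀
  · subst hj
    simp only [Function.update_self, Function.update_idem]
    ring
  · have hi : i₀ ≠ j := fun h => hj h.symm
    simp only [Function.update_of_ne hi]
    have hd : (fun k => fderiv ℝ (fun y => a y - b y) x (stdDir n k)) =
        (fun k => fderiv ℝ a x (stdDir n k)) - fun k => fderiv ℝ b x (stdDir n k) := by
      funext k
      rw [fderiv_fun_sub ha hb]
      rfl
    rw [hd, Function.update_comm hj, Function.update_comm hj, Function.update_comm hj]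
    have := (rowDet n).toMultilinearMap.map_update_sub
      (Function.update (jac (stdDir n) h x) i₀ (Pi.single S 1)) j
      (fun k => fderiv ℝ a x (stdDir n k)) (fun k => fderiv ℝ b x (stdDir n k))
    simp only [ContinuousMultilinearMap.coe_coe] at this
    rw [this]
    ring

/-- The form `h₀ dh₁ ∧ ⋯ ∧ dhₙ₋₁` depends continuously on the functions `h j`. -/
lemma hasPath_jacForm_sub (hU : IsOpen U) (hθ : 0 < θ)
    {h g : Fin n → EuclideanSpace ℝ (Fin n) → ℝ} {w : Fin n → ℝ → ℝ} {N δ : ℝ}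
    (hh : ∀ j, HasSmoothing U (h j) (w j) N) (hg : ∀ j, HasSmoothing U (g j) (w j) N)
    (hhg : ∀ j, HasSmoothing U (fun x => h j x - g j x) (w j) δ) (hN : 0 ≤ N) (hδ : 0 ≤ δ)
    (hw : ∀ t > 0, ∏ j, w j t ≤ t ^ (θ - 1)) (i₀ : Fin n) :
    HasPath U θ (fun x S => jacForm h i₀ x S - jacForm g i₀ x S)
      (n * (n * (n.factorial * (δ * N ^ (n - 1))))) := by
  have key : ∀ s : Finset (Fin n), HasPath U θ
      (fun x S => jacForm (s.piecewise h g) i₀ x S - jacForm g i₀ x S)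
      (s.card * (n * (n.factorial * (δ * N ^ (n - 1))))) := by
    intro s
    induction s using Finset.induction_on with
    | empty => simpa using HasPath.zero
    | insert j s hj ih =>
      have hone : HasPath U θ (jacForm (Function.update (s.piecewise h g) j
          (fun x => h j x - g j x)) i₀) (n * (n.factorial * (δ * N ^ (n - 1)))) := by
        have := hasPath_jacForm (h := Function.update (s.piecewise h g) j
          (fun x => h j x - g j x)) (w := w) (N := Function.update (fun _ => N) j δ) hU hθ ?_ ?_
          hw i₀
        · have hp : ∏ i, Function.update (fun _ => N) j δ i = δ * N ^ (n - 1) := by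
            rw [Finset.prod_update_of_mem (Finset.mem_univ j), Finset.prod_const]
            congr 2
            rw [Finset.card_sdiff]
            simp
          rwa [hp] at this
        · intro i
          by_cases hi : i = j
          · subst hi; simpa using hhg i
          · simp only [Function.update_of_ne hi]
            by_cases his : i ∈ s
            · simpa [his] using hh i
            · simpa [his] using hg i
        · intro i
          by_cases hi : i = j
          · subst hi; simpa using hδ
          · simpa [hi] using hN
      refine ((ih.add hU hone).congr ?_).mono ?_
      · intro x hx S
        have hd : ∀ {f : EuclideanSpace ℝ (Fin n) → ℝ}, ContDiffOn ℝ (⊤ : ℕ∞) f U →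
            DifferentiableAt ℝ f x := fun hf =>
          (hf.contDiffAt (hU.mem_nhds hx)).differentiableAt (by simp)
        rw [jacForm_update_sub (hd (hh j).contDiffOn) (hd (hg j).contDiffOn),
          ← Finset.piecewise_insert]
        have : Function.update (s.piecewise h g) j (g j) = s.piecewise h g := by
          conv_rhs => rw [← Function.update_eq_self j (s.piecewise h g)]
          rw [Finset.piecewise_eq_of_notMem _ _ _ hj]
        rw [this]
        ring
      · rw [Finset.card_insert_of_notMem hj]
        push_cast
        linarith
  have := key Finset.univ
  simpa using this

end Multilinear

section HolderBounds

variable {X : Type*} [PseudoMetricSpace X] {U : Set X} {β : ℝ}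

/-- `N` bounds both the sup norm and the Hölder seminorm of `f` on `U`. -/
def HolderBound (U : Set X) (β : ℝ) (f : X → ℝ) (N : ℝ) : Prop :=
  (∀ x ∈ U, |f x| ≤ N) ∧ ∀ x ∈ U, ∀ y ∈ U, |f x - f y| ≤ N * dist x y ^ β

lemma HolderBound.mono {f : X → ℝ} {N M : ℝ} (hf : HolderBound U β f N) (h : N ≤ M) :
    HolderBound U β f M :=
  ⟨fun x hx => (hf.1 x hx).trans h, fun x hx y hy => (hf.2 x hx y hy).trans
    (mul_le_mul_of_nonneg_right h (Real.rpow_nonneg dist_nonneg _))⟩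

lemma HolderBound.add {f g : X → ℝ} {N M : ℝ} (hf : HolderBound U β f N)
    (hg : HolderBound U β g M) : HolderBound U β (fun x => f x + g x) (N + M) := by
  refine ⟨fun x hx => (abs_add_le _ _).trans (add_le_add (hf.1 x hx) (hg.1 x hx)),
    fun x hx y hy => ?_⟩
  rw [add_sub_add_comm, add_mul]
  exact (abs_add_le _ _).trans (add_le_add (hf.2 x hx y hy) (hg.2 x hx y hy))

lemma HolderBound.mul {f g : X → ℝ} {N M : ℝ} (hf : HolderBound U β f N)
    (hg : HolderBound U β g M) (hN : 0 ≤ N) (hM : 0 ≤ M) :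
    HolderBound U β (fun x => f x * g x) (2 * N * M) := by
  refine ⟨fun x hx => ?_, fun x hx y hy => ?_⟩
  · rw [abs_mul]
    have := mul_le_mul (hf.1 x hx) (hg.1 x hx) (abs_nonneg _) hN
    nlinarith
  · rw [show f x * g x - f y * g y = (f x - f y) * g x + f y * (g x - g y) by ring]
    refine (abs_add_le _ _).trans ?_
    rw [abs_mul, abs_mul]
    have hd : 0 ≤ dist x y ^ β := Real.rpow_nonneg dist_nonneg _
    have h1 := mul_le_mul (hf.2 x hx y hy) (hg.1 x hx) (abs_nonneg _) (by positivity)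
    have h2 := mul_le_mul (hf.1 y hy) (hg.2 x hx y hy) (abs_nonneg _) hN
    linarith

lemma HolderBound.zero {N : ℝ} (hN : 0 ≤ N) : HolderBound U β (fun _ => 0) N :=
  ⟨fun x _ => by simpa using hN, fun x _ y _ => by
    simpa using mul_nonneg hN (Real.rpow_nonneg dist_nonneg _)⟩

lemma HolderBound.one : HolderBound U β (fun _ => 1) 1 :=
  ⟨fun x _ => by simp, fun x _ y _ => by
    simpa using Real.rpow_nonneg dist_nonneg _⟩

lemma HolderBound.list_prod {ι : Type*} {f g : ι → X → ℝ} {R δ : ℝ} (hR : 0 ≤ R) (hδ : 0 ≤ δ)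
    (hf : ∀ a, HolderBound U β (f a) R) (hg : ∀ a, HolderBound U β (g a) R)
    (hfg : ∀ a, HolderBound U β (fun x => f a x - g a x) δ) (A : List ι) :
    HolderBound U β (fun x => (A.map fun a => f a x).prod) ((2 * (1 + R)) ^ A.length) ∧
    HolderBound U β (fun x => (A.map fun a => g a x).prod) ((2 * (1 + R)) ^ A.length) ∧
    HolderBound U β (fun x => (A.map fun a => f a x).prod - (A.map fun a => g a x).prod)
      ((2 * (1 + R)) ^ A.length * δ) := by
  induction A with
  | nil =>
    simp only [List.map_nil, List.prod_nil, List.length_nil, pow_zero, sub_self, one_mul]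
    exact ⟨HolderBound.one, HolderBound.one, HolderBound.zero hδ⟩
  | cons a A ih =>
    obtain ⟨h1, h2, h3⟩ := ih
    set P := (2 * (1 + R)) ^ A.length with hP
    have hP0 : 0 ≤ P := by positivity
    simp only [List.map_cons, List.prod_cons, List.length_cons, pow_succ, ← hP]
    refine ⟨((hf a).mul h1 hR hP0).mono (by nlinarith), ((hg a).mul h2 hR hP0).mono (by nlinarith),
      ?_⟩
    have h4 := ((hfg a).mul h1 hδ hP0).add ((hg a).mul h3 hR (by positivity))
    have h5 : 2 * δ * P + 2 * R * (P * δ) = P * (2 * (1 + R)) * δ := by ring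
    rw [h5] at h4
    convert h4 using 2 with x
    ring

end HolderBounds

section Continuity

variable {n : ℕ} {U : Set (EuclideanSpace ℝ (Fin n))} {θ β : ℝ}

/-- Matrices of one-forms on `ℝⁿ`. -/
abbrev FormMatrix (n : ℕ) := Fin n → Fin n → EuclideanSpace ℝ (Fin n) → Fin n → ℝ

/-- Pairs of smooth matrices of one-forms bounded by `R` in Hölder norm and at distance at
most `δ` from each other. -/
structure ClosePair (U : Set (EuclideanSpace ℝ (Fin n))) (β R δ : ℝ) (ω η : FormMatrix n) :
    Prop where
  smooth_left : SmoothOneForms U ω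
  smooth_right : SmoothOneForms U η
  bound_left : C0βBoundForms U β ω R
  bound_right : C0βBoundForms U β η R
  bound_sub : C0βBoundForms U β (fun i j x k => ω i j x k - η i j x k) δ

/-- `F` is a continuous operation on bounded sets, from matrices of one-forms to functions which
can be smoothed at rate `w`. -/
def SmoothableOp (U : Set (EuclideanSpace ℝ (Fin n))) (β : ℝ) (w : ℝ → ℝ)
    (F : FormMatrix n → EuclideanSpace ℝ (Fin n) → ℝ) : Prop :=
  ∀ R > (0 : ℝ), ∃ P : ℝ, 0 ≤ P ∧ ∀ δ ≥ (0 : ℝ), ∀ ω η, ClosePair U β R δ ω η →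
    HasSmoothing U (F ω) w P ∧ HasSmoothing U (F η) w P ∧
      HasSmoothing U (fun x => F ω x - F η x) w (P * δ)

/-- Continuity on bounded sets of an operation from matrices of one-forms to
`(n - 1)`-forms. -/
def ContinuousOp (U : Set (EuclideanSpace ℝ (Fin n))) (θ β : ℝ)
    (T : FormMatrix n → EuclideanSpace ℝ (Fin n) → Fin n → ℝ) : Prop :=
  ∀ R > (0 : ℝ), ∀ ε > (0 : ℝ), ∃ δ > (0 : ℝ), ∀ ω η, ClosePair U β R δ ω η →
    HasPath U θ (fun x S => T ω x S - T η x S) ε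

lemma ClosePair.mono {R δ δ' : ℝ} {ω η : FormMatrix n} (h : ClosePair U β R δ ω η)
    (hδ : δ ≤ δ') : ClosePair U β R δ' ω η :=
  ⟨h.1, h.2, h.3, h.4, fun i j k x hx => (h.5.1 i j k x hx).trans hδ,
    fun i j k x hx y hy => (h.5.2 i j k x hx y hy).trans
      (mul_le_mul_of_nonneg_right hδ (Real.rpow_nonneg dist_nonneg _))⟩

lemma ContinuousOp.add (hU : IsOpen U)
    {T T' : FormMatrix n → EuclideanSpace ℝ (Fin n) → Fin n → ℝ}
    (h : ContinuousOp U θ β T) (h' : ContinuousOp U θ β T') :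
    ContinuousOp U θ β (fun ω x S => T ω x S + T' ω x S) := by
  intro R hR ε hε
  obtain ⟨δ, hδ, H⟩ := h R hR (ε / 2) (half_pos hε)
  obtain ⟨δ', hδ', H'⟩ := h' R hR (ε / 2) (half_pos hε)
  refine ⟨min δ δ', lt_min hδ hδ', fun ω η hc => ?_⟩
  have := (H ω η (hc.mono (min_le_left _ _))).add hU (H' ω η (hc.mono (min_le_right _ _)))
  refine (this.congr fun x _ S => ?_).mono (by linarith)
  ring

lemma ContinuousOp.const_mul (hU : IsOpen U)
    {T : FormMatrix n → EuclideanSpace ℝ (Fin n) → Fin n → ℝ}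
    (h : ContinuousOp U θ β T) (a : ℝ) :
    ContinuousOp U θ β (fun ω x S => a * T ω x S) := by
  intro R hR ε hε
  obtain ⟨δ, hδ, H⟩ := h R hR (ε / (|a| + 1)) (by positivity)
  refine ⟨δ, hδ, fun ω η hc => ?_⟩
  refine (((H ω η hc).const_mul hU a).congr fun x _ S => ?_).mono ?_
  · ring
  · rw [← mul_div_assoc, div_le_iff₀ (by positivity)]
    nlinarith [abs_nonneg a]

lemma ContinuousOp.zero : ContinuousOp U θ β (fun _ _ _ => 0) := by
  intro R hR ε hε
  refine ⟨1, one_pos, fun ω η _ => ?_⟩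
  simpa using HasPath.zero.mono hε.le

lemma contDiffOn_list_prod {ω : FormMatrix n} (hω : SmoothOneForms U ω)
    (A : List (Fin n × Fin n × Fin n)) :
    ContDiffOn ℝ (⊤ : ℕ∞) (fun x => (A.map fun a => ω a.1 a.2.1 x a.2.2).prod) U := by
  induction A with
  | nil => simpa using contDiffOn_const
  | cons a A ih =>
    simp only [List.map_cons, List.prod_cons]
    exact (hω a.1 a.2.1 a.2.2).mul ih

lemma smoothableOp_list_prod (hU : IsOpen U) (hβ : 0 < β) (hβ1 : β ≤ 1)
    (A : List (Fin n × Fin n × Fin n)) :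
    SmoothableOp U β (holderRate β)
      (fun ω x => (A.map fun a => ω a.1 a.2.1 x a.2.2).prod) := by
  intro R hR
  obtain ⟨C, hC0, hC⟩ := hasSmoothing_of_holder n hβ hβ1
  refine ⟨C * (2 * (1 + R)) ^ A.length, by positivity, fun δ hδ ω η hc => ?_⟩
  obtain ⟨h1, h2, h3⟩ := HolderBound.list_prod (U := U) (β := β) hR.le hδ
    (f := fun (a : Fin n × Fin n × Fin n) x => ω a.1 a.2.1 x a.2.2)
    (g := fun (a : Fin n × Fin n × Fin n) x => η a.1 a.2.1 x a.2.2)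
    (fun a => ⟨hc.3.1 _ _ _, hc.3.2 _ _ _⟩) (fun a => ⟨hc.4.1 _ _ _, hc.4.2 _ _ _⟩)
    (fun a => ⟨hc.5.1 _ _ _, hc.5.2 _ _ _⟩) A
  have hs := fun (ω : FormMatrix n) (hω : SmoothOneForms U ω) => contDiffOn_list_prod hω A
  rw [mul_assoc]
  exact ⟨hC U _ _ hU (by positivity) (hs ω hc.1) h1.1 h1.2,
    hC U _ _ hU (by positivity) (hs η hc.2) h2.1 h2.2,
    hC U _ _ hU (by positivity) ((hs ω hc.1).sub (hs η hc.2)) h3.1 h3.2⟩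

lemma smoothableOp_coord (k : Fin n) : SmoothableOp U β (fun _ => 1) (fun _ x => x k) := by
  intro R hR
  have h1 : HasSmoothing U (fun x => x k) (fun _ => 1) 1 := by
    simpa using hasSmoothing_const_mul_coord (U := U) (a := 1) (N := 1) (by simp) k
  refine ⟨1, zero_le_one, fun δ hδ ω η hc => ⟨h1, h1, ?_⟩⟩
  simpa using hasSmoothing_const_mul_coord (U := U) (a := 0) (N := δ) (by simpa using hδ) k

lemma continuousOp_jacForm (hU : IsOpen U) (hθ : 0 < θ) {w : Fin n → ℝ → ℝ}
    (hw0 : ∀ j, ∀ t > 0, 0 ≤ w j t) (hw : ∀ t > 0, ∏ j, w j t ≤ t ^ (θ - 1))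
    {F : Fin n → FormMatrix n → EuclideanSpace ℝ (Fin n) → ℝ}
    (hF : ∀ j, SmoothableOp U β (w j) (F j)) (i₀ : Fin n) :
    ContinuousOp U θ β (fun ω => jacForm (fun j => F j ω) i₀) := by
  intro R hR ε hε
  choose P hP0 hP using fun j => hF j R hR
  set N := ∑ j, P j with hN
  have hN0 : 0 ≤ N := Finset.sum_nonneg fun j _ => hP0 j
  have hPN : ∀ j, P j ≤ N := fun j =>
    Finset.single_le_sum (fun i _ => hP0 i) (Finset.mem_univ j)
  set K : ℝ := n * (n * (n.factorial * (N * N ^ (n - 1)))) with hK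
  have hK0 : 0 ≤ K := by positivity
  refine ⟨ε / (K + 1), by positivity, fun ω η hc => ?_⟩
  have hδ : 0 ≤ ε / (K + 1) := by positivity
  refine (hasPath_jacForm_sub (N := N) (δ := N * (ε / (K + 1))) hU hθ
    (fun j => ((hP j _ hδ ω η hc).1).mono (hw0 j) (hPN j))
    (fun j => ((hP j _ hδ ω η hc).2.1).mono (hw0 j) (hPN j))
    (fun j => ((hP j _ hδ ω η hc).2.2).mono (hw0 j) (mul_le_mul_of_nonneg_right (hPN j) hδ))
    hN0 (by positivity) hw i₀).mono ?_
  calc (n : ℝ) * (n * (n.factorial * (N * (ε / (K + 1)) * N ^ (n - 1))))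
      = K * (ε / (K + 1)) := by rw [hK]; ring
    _ ≤ ε := by
      rw [← mul_div_assoc, div_le_iff₀ (by positivity)]
      nlinarith

end Continuity

section Monomials

variable {n : ℕ}

/-- Operations from matrices of one-forms to differential forms. -/
abbrev FormOp (n : ℕ) := FormMatrix n → EuclideanSpace ℝ (Fin n) → ExtAlg n

/-- A component of the matrix of one-forms, or a coordinate function. -/
def slotFun (b : (Fin n × Fin n × Fin n) ⊕ Fin n) (ω : FormMatrix n)
    (x : EuclideanSpace ℝ (Fin n)) : ℝ :=
  b.elim (fun a => ω a.1 a.2.1 x a.2.2) fun k => x k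

/-- The differential of `slotFun`. -/
def slotGrad (b : (Fin n × Fin n × Fin n) ⊕ Fin n) (ω : FormMatrix n)
    (x : EuclideanSpace ℝ (Fin n)) : Fin n → ℝ :=
  fun k => fderiv ℝ (slotFun b ω) x (stdDir n k)

lemma slotGrad_inr (k : Fin n) (ω : FormMatrix n) (x : EuclideanSpace ℝ (Fin n)) :
    slotGrad (Sum.inr k) ω x = Pi.single k 1 := by
  funext j
  have : slotFun (Sum.inr k) ω = (EuclideanSpace.proj k : EuclideanSpace ℝ (Fin n) →L[ℝ] ℝ) := rfl
  rw [slotGrad, this, ContinuousLinearMap.fderiv]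
  by_cases h : k = j
  · subst h; simp [stdDir]
  · simp [stdDir, h]

/-- The form `(∏ ωₐ) dh₁ ∧ ⋯ ∧ dhₖ`, where the `hⱼ` are components of `ω` or coordinates. -/
def monomialOp (A : List (Fin n × Fin n × Fin n)) (L : List ((Fin n × Fin n × Fin n) ⊕ Fin n)) :
    FormOp n := fun ω x =>
  (A.map fun a => ω a.1 a.2.1 x a.2.2).prod • (L.map fun b => ιv (slotGrad b ω x)).prod

/-- Combinations of monomials of degree `D` with at most `Q` differentiated factors. -/
def monomialSpan (n Q D : ℕ) : Submodule ℝ (FormOp n) :=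
  Submodule.span ℝ {f | ∃ A L, L.countP Sum.isLeft ≤ Q ∧ L.length = D ∧ f = monomialOp A L}

lemma monomialOp_mem {Q D : ℕ} (A : List (Fin n × Fin n × Fin n))
    {L : List ((Fin n × Fin n × Fin n) ⊕ Fin n)} (hQ : L.countP Sum.isLeft ≤ Q)
    (hD : L.length = D) : monomialOp A L ∈ monomialSpan n Q D :=
  Submodule.subset_span ⟨A, L, hQ, hD, rfl⟩

lemma monomialSpan_mono {Q Q' D : ℕ} (h : Q ≤ Q') : monomialSpan n Q D ≤ monomialSpan n Q' D := by
  refine Submodule.span_mono ?_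
  rintro f ⟨A, L, hQ, hD, rfl⟩
  exact ⟨A, L, hQ.trans h, hD, rfl⟩

lemma mul_mem_monomialSpan {Q D Q' D' : ℕ} {g f : FormOp n}
    (hg : ∀ A L, L.countP Sum.isLeft ≤ Q → L.length = D →
      g * monomialOp A L ∈ monomialSpan n Q' D') (hf : f ∈ monomialSpan n Q D) :
    g * f ∈ monomialSpan n Q' D' := by
  induction hf using Submodule.span_induction with
  | mem f h => obtain ⟨A, L, hQ, hD, rfl⟩ := h; exact hg A L hQ hD
  | zero => simp
  | add f f' _ _ h h' => rw [mul_add]; exact add_mem h h'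
  | smul a f _ h => rw [mul_smul_comm]; exact Submodule.smul_mem _ _ h

lemma ιv_eq_sum (c : Fin n → ℝ) : ιv c = ∑ k, c k • ιv (Pi.single k 1) := by
  unfold ιv
  simp_rw [← map_smul, ← map_sum]
  congr 1
  funext j
  simp [Finset.sum_apply, Pi.single_apply]

lemma ιv_mul_mem {Q D : ℕ} {f : FormOp n} (hf : f ∈ monomialSpan n Q D) (i j : Fin n) :
    (fun ω x => ιv (ω i j x)) * f ∈ monomialSpan n Q (D + 1) := by
  refine mul_mem_monomialSpan (fun A L hQ hD => ?_) hf
  have : (fun ω x => ιv (ω i j x)) * monomialOp A L =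
      ∑ k, monomialOp ((i, j, k) :: A) (Sum.inr k :: L) := by
    funext ω x
    simp only [Pi.mul_apply, Finset.sum_apply, monomialOp, List.map_cons, List.prod_cons,
      slotGrad_inr]
    rw [ιv_eq_sum, Finset.sum_mul]
    refine Finset.sum_congr rfl fun k _ => ?_
    rw [smul_mul_assoc, mul_smul_comm, smul_smul]
  rw [this]
  refine Submodule.sum_mem _ fun k _ => monomialOp_mem _ ?_ ?_
  · simpa using hQ
  · simpa using hD

lemma dOneAlg_mul_mem {Q D : ℕ} {f : FormOp n} (hf : f ∈ monomialSpan n Q D) (i j : Fin n) :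
    (fun ω x => dOneAlg (ω i j) x) * f ∈ monomialSpan n (Q + 1) (D + 2) := by
  refine mul_mem_monomialSpan (fun A L hQ hD => ?_) hf
  have : (fun ω x => dOneAlg (ω i j) x) * monomialOp A L =
      ∑ l, monomialOp A (Sum.inl (i, j, l) :: Sum.inr l :: L) := by
    funext ω x
    simp only [Pi.mul_apply, Finset.sum_apply, monomialOp, List.map_cons, List.prod_cons,
      slotGrad_inr, dOneAlg]
    rw [Finset.sum_comm, Finset.sum_mul]
    refine Finset.sum_congr rfl fun l _ => ?_
    rw [ιv_eq_sum (slotGrad _ _ _), mul_smul_comm, ← mul_assoc]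
    simp only [Finset.sum_mul, smul_mul_assoc]
    rfl
  rw [this]
  refine Submodule.sum_mem _ fun k _ => monomialOp_mem _ ?_ ?_
  · rw [List.countP_cons_of_pos (by simp), List.countP_cons_of_neg (by simp)]
    omega
  · simpa using hD

lemma curvAlg_mul_mem {Q D : ℕ} {f : FormOp n} (hf : f ∈ monomialSpan n Q D) (i j : Fin n) :
    (fun ω x => curvAlg ω i j x) * f ∈ monomialSpan n (Q + 1) (D + 2) := by
  have : (fun ω x => curvAlg ω i j x) * f = (fun ω x => dOneAlg (ω i j) x) * f +
      ∑ k, (fun ω x => ιv (ω i k x)) * ((fun ω x => ιv (ω k j x)) * f) := by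
    funext ω x
    simp only [Pi.mul_apply, Pi.add_apply, Finset.sum_apply, curvAlg, add_mul, Finset.sum_mul,
      mul_assoc]
  rw [this]
  exact add_mem (dOneAlg_mul_mem hf i j) (Submodule.sum_mem _ fun k _ =>
    monomialSpan_mono (Nat.le_succ Q) (ιv_mul_mem (ιv_mul_mem hf k j) i k))

lemma list_ofFn_mul_mem {q d k : ℕ} {g : Fin k → FormOp n}
    (hg : ∀ a, ∀ {Q D : ℕ} {f : FormOp n}, f ∈ monomialSpan n Q D →
      g a * f ∈ monomialSpan n (Q + q) (D + d)) {Q D : ℕ} {f : FormOp n}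
    (hf : f ∈ monomialSpan n Q D) :
    (List.ofFn g).prod * f ∈ monomialSpan n (Q + k * q) (D + k * d) := by
  induction k with
  | zero => simpa using hf
  | succ k ih =>
    rw [List.ofFn_succ, List.prod_cons, mul_assoc, Nat.succ_mul, Nat.succ_mul, ← add_assoc,
      ← add_assoc]
    exact hg 0 (ih fun a => hg a.succ)

lemma list_ofFn_prod_apply {k : ℕ} (g : Fin k → FormOp n) (ω : FormMatrix n)
    (x : EuclideanSpace ℝ (Fin n)) :
    (List.ofFn g).prod ω x = (List.ofFn fun a => g a ω x).prod := by
  induction k with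
  | zero => simp
  | succ k ih => simp [List.ofFn_succ, ih]

lemma one_mem_monomialSpan : (1 : FormOp n) ∈ monomialSpan n 0 0 := by
  have : (1 : FormOp n) = monomialOp [] [] := by
    funext ω x
    simp [monomialOp]
  rw [this]
  exact monomialOp_mem _ (by simp) rfl

lemma list_ofFn_append_mem {k i : ℕ} (z : Fin n) (a : Fin k → Fin n) (b c : Fin i → Fin n) :
    (fun ω x => ((List.ofFn fun j => ιv (ω z (a j) x)) ++
      (List.ofFn fun j => curvAlg ω (b j) (c j) x)).prod : FormOp n) ∈
        monomialSpan n i (2 * i + k) := by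
  have h2 := list_ofFn_mul_mem (q := 0) (d := 1)
    (g := fun j => (fun ω x => ιv (ω z (a j) x) : FormOp n))
    (fun j _ _ _ hf => ιv_mul_mem hf _ _)
    (list_ofFn_mul_mem (q := 1) (d := 2)
      (g := fun j => (fun ω x => curvAlg ω (b j) (c j) x : FormOp n))
      (fun j _ _ _ hf => curvAlg_mul_mem hf _ _) one_mem_monomialSpan)
  rw [show 0 + i * 1 + k * 0 = i by omega, show 0 + i * 2 + k * 1 = 2 * i + k by omega,
    mul_one] at h2
  convert h2 using 1
  funext ω x
  rw [Pi.mul_apply, Pi.mul_apply, list_ofFn_prod_apply, list_ofFn_prod_apply, List.prod_append]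

lemma PhiAlg_mem (hn : 0 < n) (i : ℕ) (hi : i < n / 2) :
    (fun ω x => PhiAlg hn ω i hi x : FormOp n) ∈ monomialSpan n i (n - 1) := by
  have hD : n - 1 = 2 * i + (n - 2 * i - 1) := by omega
  rw [hD]
  have h1 := Submodule.sum_mem (monomialSpan n i (2 * i + (n - 2 * i - 1)))
    (t := Finset.univ.filter (fun ζ : Equiv.Perm (Fin n) => ζ ⟨0, hn⟩ = ⟨0, hn⟩))
    (f := fun ζ => ((Equiv.Perm.sign ζ : ℤ) : ℝ) • (_ : FormOp n))
    fun ζ _ => Submodule.smul_mem _ _ (list_ofFn_append_mem ⟨0, hn⟩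
      (fun j : Fin (n - 2*i - 1) => ζ ⟨j.1 + 1, by have := j.2; omega⟩)
      (fun j : Fin i => ζ ⟨n - 2*i + 2*j.1, by have h1 := j.2; have h2 := hi; omega⟩)
      (fun j : Fin i => ζ ⟨n - 2*i + 2*j.1 + 1, by have h1 := j.2; have h2 := hi; omega⟩))
  convert h1 using 1
  funext ω x
  rw [Finset.sum_apply, Finset.sum_apply]
  unfold PhiAlg
  refine Finset.sum_congr rfl fun ζ _ => ?_
  rw [Pi.smul_apply, Pi.smul_apply, Int.cast_smul_eq_zsmul]

end Monomials

section Coefficients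

variable {n : ℕ} {U : Set (EuclideanSpace ℝ (Fin n))} {θ β : ℝ}

lemma coeffFm_add (a b : ExtAlg n) (S : Fin n) :
    coeffFm n (a + b) S = coeffFm n a S + coeffFm n b S := by
  simp [coeffFm, mul_add]

lemma coeffFm_smul (r : ℝ) (a : ExtAlg n) (S : Fin n) :
    coeffFm n (r • a) S = r * coeffFm n a S := by
  simp only [coeffFm, map_smul, smul_eq_mul]
  ring

lemma coeffFm_zero (S : Fin n) : coeffFm n 0 S = 0 := by simp [coeffFm]

lemma coeffFm_monomialOp {m : ℕ} (A : List (Fin (m + 1) × Fin (m + 1) × Fin (m + 1)))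
    (v : Fin m → (Fin (m + 1) × Fin (m + 1) × Fin (m + 1)) ⊕ Fin (m + 1))
    (ω : FormMatrix (m + 1)) (x : EuclideanSpace ℝ (Fin (m + 1))) (S : Fin (m + 1)) :
    coeffFm (m + 1) (monomialOp A (List.ofFn v) ω x) S =
      jacForm (Fin.cons (fun x => (A.map fun a => ω a.1 a.2.1 x a.2.2).prod)
        fun j => slotFun (v j) ω) 0 x S := by
  rw [monomialOp, coeffFm_smul, jacForm, coeffFm, List.map_ofFn]
  have h1 : (List.ofFn ((fun b => ιv (slotGrad b ω x)) ∘ v)).prod =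
      ExteriorAlgebra.ιMulti ℝ m (fun j => slotGrad (v j) ω x) := by
    rw [ExteriorAlgebra.ιMulti_apply]
    rfl
  rw [h1, ExteriorAlgebra.liftAlternating_apply_ιMulti]
  simp only [Fin.cons_zero]
  rw [mul_left_comm]
  congr 2
  simp only [Nat.add_sub_cancel, dif_pos]
  unfold faceAlt
  rw [dif_pos (by simp)]
  have h2 : (Fin.cons (Pi.single S 1) fun j => slotGrad (v j) ω x : Fin (m + 1) → _) =
      Function.update (jac (stdDir (m + 1)) (Fin.cons
        (fun x => (A.map fun a => ω a.1 a.2.1 x a.2.2).prod) fun j => slotFun (v j) ω) x) 0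
        (Pi.single S 1) := by
    funext i
    refine Fin.cases ?_ (fun j => ?_) i
    · simp only [Fin.cons_zero, Function.update_self]
    · rw [Function.update_of_ne (Fin.succ_ne_zero j)]
      rfl
  rw [← h2]
  rfl

end Coefficients

section GaussBonnetChern

variable {n : ℕ} {U : Set (EuclideanSpace ℝ (Fin n))} {θ β : ℝ}

lemma holderRate_nonneg (β : ℝ) {t : ℝ} (ht : 0 < t) : 0 ≤ holderRate β t := by
  unfold holderRate
  split_ifs
  · exact Real.rpow_nonneg ht.le _
  · exact le_rfl

lemma holderRate_pow_le {q : ℕ} (hq : q ≠ 0) (h : q * (1 - β) ≤ 1 - θ) {t : ℝ} (ht : 0 < t) :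
    holderRate β t ^ q ≤ t ^ (θ - 1) := by
  unfold holderRate
  split_ifs with h1
  · rw [← Real.rpow_natCast, ← Real.rpow_mul ht.le]
    exact Real.rpow_le_rpow_of_exponent_ge ht h1 (by linarith)
  · rw [zero_pow hq]
    exact Real.rpow_nonneg ht.le _

lemma prod_ite_isLeft {α γ : Type*} {m : ℕ} (v : Fin m → α ⊕ γ) (r : ℝ) :
    ∏ j, (if (v j).isLeft then r else 1) = r ^ (List.ofFn v).countP Sum.isLeft := by
  induction m with
  | zero => simp
  | succ m ih =>
    rw [Fin.prod_univ_succ, ih, List.ofFn_succ, List.countP_cons]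
    split_ifs
    · rw [pow_succ']
    · simp

lemma smoothableOp_slotFun (hU : IsOpen U) (hβ : 0 < β) (hβ1 : β ≤ 1)
    (b : (Fin n × Fin n × Fin n) ⊕ Fin n) :
    SmoothableOp U β (fun t => if b.isLeft then holderRate β t else 1) (slotFun b) := by
  rcases b with a | k
  · have h := smoothableOp_list_prod hU hβ hβ1 [a]
    simp only [List.map_cons, List.map_nil, List.prod_cons, List.prod_nil, mul_one] at h
    simp only [Sum.isLeft_inl, if_true]
    exact h
  · simp only [Sum.isLeft_inr, Bool.false_eq_true, if_false]
    exact smoothableOp_coord k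

lemma continuousOp_monomialOp (hU : IsOpen U) (hβ : 0 < β) (hβ1 : β ≤ 1) (hθ : 0 < θ)
    (hn : 0 < n) {Q : ℕ} (hQ : ((Q + 1 : ℕ) : ℝ) * (1 - β) ≤ 1 - θ)
    (A : List (Fin n × Fin n × Fin n)) (L : List ((Fin n × Fin n × Fin n) ⊕ Fin n))
    (hL : L.countP Sum.isLeft ≤ Q) (hD : L.length = n - 1) :
    ContinuousOp U θ β (fun ω x S => coeffFm n (monomialOp A L ω x) S) := by
  obtain ⟨m, rfl⟩ := Nat.exists_eq_succ_of_ne_zero hn.ne'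
  obtain ⟨v, rfl⟩ : ∃ v : Fin m → _, L = List.ofFn v :=
    ⟨fun j => L.get (j.cast hD.symm), List.ext_getElem (by simpa using hD) (by simp)⟩
  let w : Fin (m + 1) → ℝ → ℝ :=
    Fin.cons (holderRate β) fun j t => if (v j).isLeft then holderRate β t else 1
  let F : Fin (m + 1) → FormMatrix (m + 1) → EuclideanSpace ℝ (Fin (m + 1)) → ℝ :=
    Fin.cons (fun ω x => (A.map fun a => ω a.1 a.2.1 x a.2.2).prod) fun j => slotFun (v j)
  have hw0 : ∀ j, ∀ t > 0, 0 ≤ w j t := by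
    refine Fin.cases (fun t ht => holderRate_nonneg β ht) fun j t ht => ?_
    simp only [w, Fin.cons_succ]
    split_ifs
    · exact holderRate_nonneg β ht
    · exact zero_le_one
  have hw : ∀ t > 0, ∏ j, w j t ≤ t ^ (θ - 1) := by
    intro t ht
    simp only [w, Fin.prod_univ_succ, Fin.cons_zero, Fin.cons_succ]
    rw [prod_ite_isLeft, ← pow_succ']
    refine holderRate_pow_le (Nat.succ_ne_zero _) (le_trans ?_ hQ) ht
    have : (((List.ofFn v).countP Sum.isLeft + 1 : ℕ) : ℝ) ≤ ((Q + 1 : ℕ) : ℝ) := by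
      exact_mod_cast Nat.succ_le_succ hL
    exact mul_le_mul_of_nonneg_right this (by linarith)
  have hF : ∀ j, SmoothableOp U β (w j) (F j) :=
    Fin.cases (smoothableOp_list_prod hU hβ hβ1 A) fun j => smoothableOp_slotFun hU hβ hβ1 (v j)
  convert continuousOp_jacForm hU hθ hw0 hw hF 0 using 1
  funext ω x S
  rw [coeffFm_monomialOp]
  congr 1
  funext j
  refine Fin.cases rfl (fun j => rfl) j

lemma continuousOp_of_mem_monomialSpan (hU : IsOpen U) (hβ : 0 < β) (hβ1 : β ≤ 1) (hθ : 0 < θ)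
    (hn : 0 < n) {Q : ℕ} (hQ : ((Q + 1 : ℕ) : ℝ) * (1 - β) ≤ 1 - θ)
    {T : FormOp n} (hT : T ∈ monomialSpan n Q (n - 1)) :
    ContinuousOp U θ β (fun ω x S => coeffFm n (T ω x) S) := by
  induction hT using Submodule.span_induction with
  | mem T h =>
    obtain ⟨A, L, hL, hD, rfl⟩ := h
    exact continuousOp_monomialOp hU hβ hβ1 hθ hn hQ A L hL hD
  | zero => simpa only [Pi.zero_apply, coeffFm_zero] using ContinuousOp.zero
  | add f g _ _ hf hg => simpa only [Pi.add_apply, coeffFm_add] using hf.add hU hg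
  | smul a f _ hf => simpa only [Pi.smul_apply, coeffFm_smul] using hf.const_mul hU a

lemma continuousOp_GBCPrimitive (hU : IsOpen U) (hβ : 0 < β) (hβ1 : β ≤ 1) (hθ : 0 < θ)
    (hn : 0 < n) (hn2 : Even n) (hβn : θ < (n : ℝ) * β / 2 - ((n : ℝ) / 2 - 1)) :
    ContinuousOp U θ β (fun ω => GBCPrimitive hn ω) := by
  have hmem : (fun ω x => (Real.pi ^ n)⁻¹ • ∑ i : Fin (n / 2),
      (((-1 : ℝ) ^ (i : ℕ)) / ((∏ j ∈ Finset.range (n - i), (2 * (j : ℝ) + 1)) *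
        (Nat.factorial i) * 2 ^ (n + (i : ℕ)))) • PhiAlg hn ω i.1 i.2 x : FormOp n) ∈
        monomialSpan n (n / 2 - 1) (n - 1) := by
    have h1 := Submodule.smul_mem (monomialSpan n (n / 2 - 1) (n - 1)) (Real.pi ^ n)⁻¹
      (Submodule.sum_mem _ (t := Finset.univ) fun (i : Fin (n / 2)) _ =>
        Submodule.smul_mem _ (((-1 : ℝ) ^ (i : ℕ)) /
          ((∏ j ∈ Finset.range (n - i), (2 * (j : ℝ) + 1)) *
            (Nat.factorial i) * 2 ^ (n + (i : ℕ))))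
          (monomialSpan_mono (Nat.le_sub_one_of_lt i.2) (PhiAlg_mem hn i.1 i.2)))
    convert h1 using 1
    funext ω x
    simp only [Pi.smul_apply, Finset.sum_apply]
  refine continuousOp_of_mem_monomialSpan hU hβ hβ1 hθ hn ?_ hmem
  obtain ⟨k, rfl⟩ := hn2
  rw [show (k + k) / 2 - 1 + 1 = k by omega]
  push_cast at hβn
  nlinarith

end GaussBonnetChern

/-- Remark 3.2: for even `n` and `β ∈ (0,1)` with `nβ/2 − (n/2 − 1) > 0`, the
map `ω ↦ Π(ω)` (a polynomial in the `ωⁱⱼ` and `dωⁱⱼ`) is continuous from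
`C^{0,β}(U;Λ¹ℝⁿ)^{n×n}` to `X_θ` for every `θ < nβ/2 − (n/2 − 1)`; continuity is expressed in
`ε`-`δ` form on bounded sets of smooth matrices of one-forms (which characterizes the continuous
extension by density). -/
theorem GBC_primitive_continuous
    (n : ℕ) (hn : Even n) (hn0 : 0 < n)
    (U : Set (EuclideanSpace ℝ (Fin n))) (hUo : IsOpen U) (hUb : Bornology.IsBounded U)
    (β : ℝ) (hβ : β ∈ Set.Ioo (0:ℝ) 1)
    (hβn : 0 < (n : ℝ) * β / 2 - ((n : ℝ) / 2 - 1))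
    (θ : ℝ) (hθ₀ : 0 < θ) (hθ : θ < (n : ℝ) * β / 2 - ((n : ℝ) / 2 - 1)) (hθ₁ : θ < 1) :
    ∀ R > (0:ℝ), ∀ ε > (0:ℝ), ∃ δ > (0:ℝ),
      ∀ ω η : Fin n → Fin n → EuclideanSpace ℝ (Fin n) → Fin n → ℝ,
        SmoothOneForms U ω → SmoothOneForms U η →
        C0βBoundForms U β ω R → C0βBoundForms U β η R →
        C0βBoundForms U β (fun i j x k => ω i j x k - η i j x k) δ →
        XthetaNorm U θ (fun x S => GBCPrimitive hn0 ω x S - GBCPrimitive hn0 η x S)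
          ≤ ENNReal.ofReal ε := by
  intro R hR ε hε
  obtain ⟨δ, hδ, H⟩ := continuousOp_GBCPrimitive hUo hβ.1 hβ.2.le hθ₀ hn0 hn hθ R hR (ε / 2)
    (half_pos hε)
  refine ⟨δ, hδ, fun ω η h1 h2 h3 h4 h5 => (H ω η ⟨h1, h2, h3, h4, h5⟩).XthetaNorm_le.trans ?_⟩
  rw [← ENNReal.ofReal_add (half_pos hε).le (half_pos hε).le, add_halves]

end
end

section
/- Let V ⊂ ℝⁿ be open and bounded, let U ⊂⊂ V be open with n − 1 < dim_box ∂U = d < n, let 0 < α < 1 with nα > d, and let u ∈ C^{0,α}(V; ℝⁿ). Then the Lebesgue measure of the ε-neighborhood of u(∂U) tends to zero: ℒⁿ( (u(∂U))_ε ) → 0 as ε → 0; in particular ℒⁿ(u(∂U)) = 0. -/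
/-!
STATEMENT 11: V ⊂ ℝⁿ open bounded, U ⊂⊂ V open with n−1 < dim_box ∂U = d < n, 0 < α < 1 with
nα > d, u ∈ C^{0,α}(V;ℝⁿ).  Then ℒⁿ((u(∂U))_ε) → 0 as ε → 0⁺; in particular ℒⁿ(u(∂U)) = 0.
Here (A)_ε = { x : dist(x,A) < ε } is the open ε-neighborhood (Metric.thickening).
-/

noncomputable section

open Filter Set ENNReal MeasureTheory

/-- Upper Hausdorff-type content `H̄^β(E)` of a set in a metric space. -/
def upperContent {X : Type*} [PseudoMetricSpace X] (β : ℝ) (E : Set X) : ℝ≥0∞ :=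
  Filter.limsup
    (fun ε : ℝ =>
      ⨅ (m : ℕ) (x : Fin m → X) (_ : E ⊆ ⋃ i, Metric.ball (x i) ε),
        (m : ℝ≥0∞) * ENNReal.ofReal (ε ^ β))
    (nhdsWithin 0 (Set.Ioi (0:ℝ)))

/-- Upper box dimension, `dim_box E = sup { s > 0 : H̄^s(E) = ∞ }` (with `sSup ∅ = 0`). -/
def dimBox {X : Type*} [PseudoMetricSpace X] (E : Set X) : ℝ :=
  sSup {s : ℝ | 0 < s ∧ upperContent s E = ⊤}

theorem upperContent_ne_top_of_dimBox_lt {X : Type*} [PseudoMetricSpace X] {E : Set X} {s : ℝ}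
    (hpos : 0 < dimBox E) (hs : dimBox E < s) : upperContent s E ≠ ⊤ := by
  intro htop
  have hbdd : BddAbove {s : ℝ | 0 < s ∧ upperContent s E = ⊤} := by
    by_contra hn
    have h0 : dimBox E = 0 := Real.sSup_of_not_bddAbove hn
    exact hpos.ne' h0
  have hle : s ≤ dimBox E := le_csSup hbdd ⟨hpos.trans hs, htop⟩
  exact absurd hs hle.not_gt

theorem exists_eventually_cover_of_upperContent_ne_top {X : Type*} [PseudoMetricSpace X]
    {E : Set X} {s : ℝ} (h : upperContent s E ≠ ⊤) :
    ∃ M : ℝ≥0∞, M ≠ ⊤ ∧ ∀ᶠ ε : ℝ in nhdsWithin 0 (Set.Ioi (0:ℝ)),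
      ∃ (m : ℕ) (x : Fin m → X), E ⊆ ⋃ i, Metric.ball (x i) ε ∧
        (m : ℝ≥0∞) * ENNReal.ofReal (ε ^ s) ≤ M := by
  obtain ⟨M, hM, hMtop⟩ := exists_between (lt_top_iff_ne_top.2 h)
  refine ⟨M, hMtop.ne, ?_⟩
  filter_upwards [Filter.eventually_lt_of_limsup_lt hM] with ε hε
  simp only [iInf_lt_iff] at hε
  obtain ⟨m, x, hx, hlt⟩ := hε
  exact ⟨m, x, hx, hlt.le⟩

/-- A cover of `E` by `ε`-balls yields a cover of the `ε ^ α`-thickening of the image of `E` under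
an `α`-Hölder map by balls of radius comparable to `ε ^ α`. -/
theorem exists_thickening_image_subset_iUnion_ball {X Y : Type*} [PseudoMetricSpace X]
    [PseudoMetricSpace Y] {E : Set X} {u : X → Y} {C α ε : ℝ} (hα : 0 < α) (hε : 0 < ε)
    (hu : ∀ x ∈ E, ∀ x' ∈ E, dist (u x) (u x') ≤ C * dist x x' ^ α)
    {ι : Type*} {x : ι → X} (hx : E ⊆ ⋃ i, Metric.ball (x i) ε) :
    ∃ y : ι → Y, Metric.thickening (ε ^ α) (u '' E) ⊆
      ⋃ i, Metric.ball (y i) ((|C| * 2 ^ α + 1) * ε ^ α) := by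
  classical
  have hz : ∀ i, ∃ z : X, (E ∩ Metric.ball (x i) ε).Nonempty → z ∈ E ∩ Metric.ball (x i) ε := by
    intro i
    by_cases h : (E ∩ Metric.ball (x i) ε).Nonempty
    · exact ⟨h.some, fun _ => h.some_mem⟩
    · exact ⟨x i, fun h' => absurd h' h⟩
  choose z hz using hz
  refine ⟨fun i => u (z i), fun p hp => ?_⟩
  obtain ⟨_, ⟨w, hw, rfl⟩, hpw⟩ := Metric.mem_thickening_iff.1 hp
  obtain ⟨i, hi⟩ := Set.mem_iUnion.1 (hx hw)
  obtain ⟨hzE, hzb⟩ := hz i ⟨w, hw, hi⟩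
  refine Set.mem_iUnion.2 ⟨i, ?_⟩
  rw [Metric.mem_ball] at hi hzb ⊢
  have hwz : dist w (z i) ≤ 2 * ε := by
    linarith [dist_triangle_right w (z i) (x i)]
  have hpow : dist w (z i) ^ α ≤ 2 ^ α * ε ^ α := by
    rw [← Real.mul_rpow zero_le_two hε.le]
    exact Real.rpow_le_rpow dist_nonneg hwz hα.le
  have hC : dist (u w) (u (z i)) ≤ |C| * (2 ^ α * ε ^ α) :=
    calc dist (u w) (u (z i)) ≤ C * dist w (z i) ^ α := hu w hw _ hzE
      _ ≤ |C| * dist w (z i) ^ α := by gcongr; exact le_abs_self C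
      _ ≤ |C| * (2 ^ α * ε ^ α) := by gcongr
  linarith [dist_triangle p (u w) (u (z i))]

theorem tendsto_rpow_nhdsGT_zero {a : ℝ} (ha : 0 < a) :
    Tendsto (fun r : ℝ => r ^ a) (nhdsWithin 0 (Set.Ioi (0:ℝ)))
      (nhdsWithin 0 (Set.Ioi (0:ℝ))) := by
  refine tendsto_nhdsWithin_iff.2 ⟨?_, ?_⟩
  · have h := (Real.continuousAt_rpow_const 0 a (Or.inr ha.le)).tendsto
    rw [Real.zero_rpow ha.ne'] at h
    exact h.mono_left nhdsWithin_le_nhds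
  · filter_upwards [self_mem_nhdsWithin] with r hr
    exact Real.rpow_pos_of_pos hr a

theorem tendsto_measure_thickening_image_of_upperContent_ne_top {X F : Type*}
    [PseudoMetricSpace X] [NormedAddCommGroup F] [NormedSpace ℝ F] [FiniteDimensional ℝ F]
    [MeasurableSpace F] [BorelSpace F] (μ : Measure F) [μ.IsAddHaarMeasure]
    {E : Set X} {u : X → F} {C α s : ℝ} (hα : 0 < α)
    (hu : ∀ x ∈ E, ∀ x' ∈ E, dist (u x) (u x') ≤ C * dist x x' ^ α)
    (hE : upperContent s E ≠ ⊤) (hs : s < Module.finrank ℝ F * α) :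
    Tendsto (fun ε : ℝ => μ (Metric.thickening ε (u '' E)))
      (nhdsWithin 0 (Set.Ioi (0:ℝ))) (nhds 0) := by
  set n := Module.finrank ℝ F
  set K : ℝ := |C| * 2 ^ α + 1
  have hK : 0 < K := by positivity
  obtain ⟨M, hM, hcover⟩ := exists_eventually_cover_of_upperContent_ne_top hE
  set A : ℝ≥0∞ := M * (ENNReal.ofReal (K ^ n) * μ (Metric.ball 0 1))
  have hA : A ≠ ⊤ :=
    ENNReal.mul_ne_top hM (ENNReal.mul_ne_top ENNReal.ofReal_ne_top measure_ball_lt_top.ne)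
  have hbound : ∀ᶠ ε : ℝ in nhdsWithin 0 (Set.Ioi (0:ℝ)),
      μ (Metric.thickening (ε ^ α) (u '' E)) ≤ A * ENNReal.ofReal (ε ^ (n * α - s)) := by
    filter_upwards [hcover, self_mem_nhdsWithin] with ε ⟨m, x, hx, hm⟩ (hε : 0 < ε)
    obtain ⟨y, hy⟩ := exists_thickening_image_subset_iUnion_ball hα hε hu hx
    have hpow : (K * ε ^ α) ^ n = ε ^ s * (K ^ n * ε ^ (n * α - s)) := by
      have h : ε ^ s * ε ^ (n * α - s) = (ε ^ α) ^ n := by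
        rw [← Real.rpow_add hε, ← Real.rpow_natCast, ← Real.rpow_mul hε.le]
        ring_nf
      rw [mul_pow, ← h]
      ring
    calc μ (Metric.thickening (ε ^ α) (u '' E))
        ≤ μ (⋃ i, Metric.ball (y i) (K * ε ^ α)) := measure_mono hy
      _ ≤ ∑ i, μ (Metric.ball (y i) (K * ε ^ α)) := measure_iUnion_fintype_le μ _
      _ = m * (ENNReal.ofReal ((K * ε ^ α) ^ n) * μ (Metric.ball 0 1)) := by
        simp [Measure.addHaar_ball_of_pos μ _ (show 0 < K * ε ^ α by positivity), n]
      _ = (m * ENNReal.ofReal (ε ^ s)) * (ENNReal.ofReal (K ^ n) * μ (Metric.ball 0 1)) *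
            ENNReal.ofReal (ε ^ (n * α - s)) := by
        rw [hpow, ENNReal.ofReal_mul (by positivity), ENNReal.ofReal_mul (by positivity)]
        ring
      _ ≤ A * ENNReal.ofReal (ε ^ (n * α - s)) := mul_le_mul_left (mul_le_mul_left hm _) _
  have hlim : Tendsto (fun ε : ℝ => A * ENNReal.ofReal (ε ^ (n * α - s)))
      (nhdsWithin 0 (Set.Ioi (0:ℝ))) (nhds 0) := by
    have h := (tendsto_rpow_nhdsGT_zero (sub_pos.2 hs)).mono_right nhdsWithin_le_nhds
    simpa using ENNReal.Tendsto.const_mul (ENNReal.tendsto_ofReal h) (Or.inr hA)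
  have hcomp := (tendsto_of_tendsto_of_tendsto_of_le_of_le' tendsto_const_nhds hlim
    (Eventually.of_forall fun _ => zero_le) hbound).comp
    (tendsto_rpow_nhdsGT_zero (inv_pos.2 hα))
  refine hcomp.congr' ?_
  filter_upwards [self_mem_nhdsWithin] with r (hr : 0 < r)
  simp only [Function.comp_apply, Real.rpow_inv_rpow hr.le hα.ne']

theorem measure_thickening_image_boundary_tendsto_zero
    (n : ℕ) (V U : Set (EuclideanSpace ℝ (Fin n)))
    (hVo : IsOpen V) (hVb : Bornology.IsBounded V)
    (hUo : IsOpen U) (hUV : closure U ⊆ V)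
    (d : ℝ) (hd : dimBox (frontier U) = d)
    (hd₁ : (n : ℝ) - 1 < d) (hd₂ : d < n)
    (α : ℝ) (hα : α ∈ Set.Ioo (0:ℝ) 1) (hαd : d < n * α)
    (u : EuclideanSpace ℝ (Fin n) → EuclideanSpace ℝ (Fin n))
    (C : ℝ) (hu : ∀ x ∈ V, ∀ x' ∈ V, dist (u x) (u x') ≤ C * dist x x' ^ α) :
    Tendsto (fun ε : ℝ => volume (Metric.thickening ε (u '' frontier U)))
        (nhdsWithin 0 (Set.Ioi (0:ℝ))) (nhds 0) ∧
    volume (u '' frontier U) = 0 := by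
  subst hd
  have hpos : 0 < dimBox (frontier U) := by
    have hnonneg : 0 ≤ dimBox (frontier U) := Real.sSup_nonneg fun s hs => hs.1.le
    have hn : (1 : ℝ) ≤ n := by
      have h : 0 < n := by exact_mod_cast hnonneg.trans_lt hd₂
      exact_mod_cast h
    linarith
  have hUf : frontier U ⊆ V := frontier_subset_closure.trans hUV
  obtain ⟨s, hds, hsα⟩ := exists_between hαd
  have hlim : Tendsto (fun ε : ℝ => volume (Metric.thickening ε (u '' frontier U)))
      (nhdsWithin 0 (Set.Ioi (0:ℝ))) (nhds 0) :=
    tendsto_measure_thickening_image_of_upperContent_ne_top volume hα.1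
      (fun x hx x' hx' => hu x (hUf hx) x' (hUf hx'))
      (upperContent_ne_top_of_dimBox_lt hpos hds) (by simpa using hsα)
  refine ⟨hlim, le_antisymm (ge_of_tendsto hlim ?_) zero_le⟩
  filter_upwards [self_mem_nhdsWithin] with ε hε
  exact measure_mono (Metric.self_subset_thickening hε _)
end
end

section
/- Let U ⊂ ℝⁿ be open, let u ∈ C²(U; ℝⁿ), and let ψ ∈ C¹(ℝⁿ; ℝⁿ). Then pointwise on U one has the identity Σ_{j=1}^n ∂_j ( Σ_{i=1}^n ψ_i(u(x)) (cof Du(x))_{ij} ) = (div ψ)(u(x)) · det Du(x); that is, (div ψ)∘u · det Du = div( (cof Du)ᵀ (ψ∘u) ). -/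
/-!
STATEMENT 14: Let U ⊂ ℝⁿ be open, u ∈ C²(U;ℝⁿ), ψ ∈ C¹(ℝⁿ;ℝⁿ). Then pointwise on U:
  Σⱼ ∂ⱼ ( Σᵢ ψᵢ(u x) (cof Du x)ᵢⱼ ) = (div ψ)(u x) · det Du(x),
where cof A is the cofactor matrix, characterized by A (cof A)ᵀ = det A · Id,
i.e. cof A = (adjugate A)ᵀ.
-/

noncomputable section

open EuclideanSpace

/-- The Jacobian matrix of a map `u : ℝⁿ → ℝⁿ` at a point, `(Du)_{ij} = ∂_j u_i`. -/
def jacMatrix (n : ℕ) (u : EuclideanSpace ℝ (Fin n) → EuclideanSpace ℝ (Fin n))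
    (x : EuclideanSpace ℝ (Fin n)) : Matrix (Fin n) (Fin n) ℝ :=
  Matrix.of fun i j => fderiv ℝ u x (EuclideanSpace.single j 1) i

/-- The cofactor matrix, `cof A = (adjugate A).transpose`, so that `A * (cof A).transpose = det A • 1`. -/
def cofMatrix {n : ℕ} (A : Matrix (Fin n) (Fin n) ℝ) : Matrix (Fin n) (Fin n) ℝ :=
  (Matrix.adjugate A).transpose

namespace Matrix

variable {m R : Type*} [Fintype m] [DecidableEq m] [CommRing R]

theorem det_updateRow_updateRow_swap (M : Matrix m m R) {i k : m} (hik : i ≠ k) (v w : m → R) :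
    ((M.updateRow i v).updateRow k w).det = -((M.updateRow i w).updateRow k v).det := by
  have h := (detRowAlternating (R := R) (n := m)).map_swap
    ((M.updateRow i w).updateRow k v) hik
  refine Eq.trans (congrArg detRowAlternating ?_) h
  ext a b
  change ((M.updateRow i v).updateRow k w) a b =
    ((M.updateRow i w).updateRow k v) (Equiv.swap i k a) b
  rcases eq_or_ne a i with rfl | hai
  · simp [updateRow_apply, hik]
  rcases eq_or_ne a k with rfl | hak
  · simp [updateRow_apply, hik]
  · simp [updateRow_apply, hai, hak, Equiv.swap_apply_of_ne_of_ne hai hak]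

theorem det_updateRow_eq_sum (M : Matrix m m R) (k : m) (w : m → R) :
    (M.updateRow k w).det = ∑ l, w l * (M.updateRow k (Pi.single l 1)).det := by
  have h := LinearMap.pi_apply_eq_sum_univ
    ((detRowAlternating (R := R) (n := m)).toMultilinearMap.toLinearMap M k) w
  refine h.trans (Finset.sum_congr rfl fun l _ => ?_)
  have hl : (fun j => if l = j then (1 : R) else 0) = Pi.single l 1 := by
    ext j
    simp [Pi.single_apply, eq_comm]
  rw [hl]
  rfl

theorem sum_det_updateRow_single_updateRow_eq_zero (M : Matrix m m ℝ) {i k : m} (hik : i ≠ k)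
    {H : m → m → ℝ} (hH : ∀ j l, H j l = H l j) :
    ∑ j, ((M.updateRow i (Pi.single j 1)).updateRow k (H j)).det = 0 := by
  simp_rw [det_updateRow_eq_sum _ k (H _)]
  refine self_eq_neg.mp ?_
  conv_lhs => rw [Finset.sum_comm]
  simp_rw [← Finset.sum_neg_distrib]
  refine Finset.sum_congr rfl fun l _ => Finset.sum_congr rfl fun j _ => ?_
  rw [det_updateRow_updateRow_swap M hik, hH, mul_neg]

end Matrix

/-- The determinant as a continuous multilinear map of the rows. -/
def detRowContinuousMultilinear (m : Type*) [Fintype m] [DecidableEq m] :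
    ContinuousMultilinearMap ℝ (fun _ : m => m → ℝ) ℝ where
  toMultilinearMap := (Matrix.detRowAlternating (R := ℝ) (n := m)).toMultilinearMap
  cont := (continuous_id (X := Matrix m m ℝ)).matrix_det

theorem cofMatrix_apply {n : ℕ} (A : Matrix (Fin n) (Fin n) ℝ) (i j : Fin n) :
    cofMatrix A i j = (A.updateRow i (Pi.single j 1)).det := by
  rw [cofMatrix, Matrix.transpose_apply, Matrix.adjugate_apply]

theorem hasFDerivAt_jacMatrix_row {n : ℕ}
    {u : EuclideanSpace ℝ (Fin n) → EuclideanSpace ℝ (Fin n)} {x : EuclideanSpace ℝ (Fin n)}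
    (hu : DifferentiableAt ℝ (fderiv ℝ u) x) (k : Fin n) :
    HasFDerivAt (fun y => jacMatrix n u y k)
      (ContinuousLinearMap.pi fun l => (EuclideanSpace.proj k).comp
        ((fderiv ℝ (fderiv ℝ u) x).flip (EuclideanSpace.single l 1))) x := by
  refine hasFDerivAt_pi.2 fun l => ?_
  have h := hu.hasFDerivAt.clm_apply (hasFDerivAt_const (EuclideanSpace.single l (1 : ℝ)) x)
  have h' := (EuclideanSpace.proj k : EuclideanSpace ℝ (Fin n) →L[ℝ] ℝ).hasFDerivAt.comp x h
  refine h'.congr_fderiv ?_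
  ext v
  simp

theorem exists_hasFDerivAt_cofMatrix {n : ℕ}
    {u : EuclideanSpace ℝ (Fin n) → EuclideanSpace ℝ (Fin n)} {x : EuclideanSpace ℝ (Fin n)}
    (hu : DifferentiableAt ℝ (fderiv ℝ u) x) (i j : Fin n) :
    ∃ L : EuclideanSpace ℝ (Fin n) →L[ℝ] ℝ,
      HasFDerivAt (fun y => cofMatrix (jacMatrix n u y) i j) L x ∧
      ∀ v, L v = ∑ k ∈ Finset.univ.erase i,
        (((jacMatrix n u x).updateRow i (Pi.single j 1)).updateRow k
          fun l => fderiv ℝ (fderiv ℝ u) x v (EuclideanSpace.single l 1) k).det := by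
  have hrow : ∀ k, HasFDerivAt
      (fun y => (jacMatrix n u y).updateRow i (Pi.single j 1) k)
      (if k = i then 0 else ContinuousLinearMap.pi fun l => (EuclideanSpace.proj k).comp
        ((fderiv ℝ (fderiv ℝ u) x).flip (EuclideanSpace.single l 1))) x := by
    intro k
    split_ifs with hk
    · subst hk
      simpa using hasFDerivAt_const (𝕜 := ℝ) (Pi.single j 1 : Fin n → ℝ) x
    · simpa [Matrix.updateRow_ne hk] using hasFDerivAt_jacMatrix_row hu k
  have h := HasFDerivAt.multilinear_comp (f := detRowContinuousMultilinear (Fin n)) hrow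
  refine ⟨_, h.congr_of_eventuallyEq (.of_forall fun y => cofMatrix_apply _ i j), fun v => ?_⟩
  rw [sum_apply, ← Finset.add_sum_erase _ _ (Finset.mem_univ i)]
  simp only [if_true, ContinuousLinearMap.comp_zero, zero_apply, zero_add]
  refine Finset.sum_congr rfl fun k hk => ?_
  rw [if_neg (Finset.ne_of_mem_erase hk)]
  rfl

/-- The Piola identity: the rows of the cofactor matrix of a Jacobian are divergence free. -/
theorem sum_fderiv_cofMatrix_jacMatrix_eq_zero {n : ℕ}
    {u : EuclideanSpace ℝ (Fin n) → EuclideanSpace ℝ (Fin n)} {x : EuclideanSpace ℝ (Fin n)}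
    (hu : ContDiffAt ℝ 2 u x) (i : Fin n) :
    ∑ j, fderiv ℝ (fun y => cofMatrix (jacMatrix n u y) i j) x (EuclideanSpace.single j 1) = 0 := by
  have hd : DifferentiableAt ℝ (fderiv ℝ u) x :=
    (hu.fderiv_right (m := 1) (by norm_num)).differentiableAt (by norm_num)
  have hsymm : IsSymmSndFDerivAt ℝ u x := hu.isSymmSndFDerivAt (by simp)
  choose L hL hLv using fun j => exists_hasFDerivAt_cofMatrix hd i j
  simp_rw [fun j => (hL j).fderiv, hLv]
  rw [Finset.sum_comm]
  refine Finset.sum_eq_zero fun k hk => ?_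
  exact Matrix.sum_det_updateRow_single_updateRow_eq_zero (jacMatrix n u x)
    (Finset.ne_of_mem_erase hk).symm fun j l => by rw [hsymm.eq]

theorem fderiv_comp_apply_single_eq_sum {n : ℕ}
    {u ψ : EuclideanSpace ℝ (Fin n) → EuclideanSpace ℝ (Fin n)} {x : EuclideanSpace ℝ (Fin n)}
    (hu : DifferentiableAt ℝ u x) (hψ : DifferentiableAt ℝ ψ (u x)) (i j : Fin n) :
    fderiv ℝ (fun y => ψ (u y) i) x (EuclideanSpace.single j 1) =
      (jacMatrix n ψ (u x) * jacMatrix n u x) i j := by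
  have h := (EuclideanSpace.proj i : EuclideanSpace ℝ (Fin n) →L[ℝ] ℝ).hasFDerivAt.comp x
    (hψ.hasFDerivAt.comp x hu.hasFDerivAt)
  have hw : ∀ w : EuclideanSpace ℝ (Fin n), w = ∑ k, w k • EuclideanSpace.single k (1 : ℝ) := by
    intro w
    ext l
    simp [Pi.single_apply]
  refine (congrArg (· (EuclideanSpace.single j 1)) h.fderiv).trans ?_
  change fderiv ℝ ψ (u x) (fderiv ℝ u x (EuclideanSpace.single j 1)) i = _
  rw [hw (fderiv ℝ u x (EuclideanSpace.single j 1)), map_sum, Matrix.mul_apply]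
  simp [jacMatrix, mul_comm]

theorem div_psi_comp_det_eq_div_cof
    (n : ℕ) (U : Set (EuclideanSpace ℝ (Fin n))) (hU : IsOpen U)
    (u : EuclideanSpace ℝ (Fin n) → EuclideanSpace ℝ (Fin n))
    (hu : ContDiffOn ℝ 2 u U)
    (ψ : EuclideanSpace ℝ (Fin n) → EuclideanSpace ℝ (Fin n))
    (hψ : ContDiff ℝ 1 ψ) :
    ∀ x ∈ U,
      (∑ j : Fin n,
        fderiv ℝ (fun y => ∑ i : Fin n, ψ (u y) i * cofMatrix (jacMatrix n u y) i j) x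
          (EuclideanSpace.single j 1))
      =
      (∑ i : Fin n, fderiv ℝ ψ (u x) (EuclideanSpace.single i 1) i) *
        (jacMatrix n u x).det := by
  intro x hx
  have hux : ContDiffAt ℝ 2 u x := hu.contDiffAt (hU.mem_nhds hx)
  have hd : DifferentiableAt ℝ u x := hux.differentiableAt (by norm_num)
  have hψd : DifferentiableAt ℝ ψ (u x) := (hψ.differentiable (by norm_num)).differentiableAt
  have hd2 : DifferentiableAt ℝ (fderiv ℝ u) x :=
    (hux.fderiv_right (m := 1) (by norm_num)).differentiableAt (by norm_num)
  have hcof : ∀ i j, DifferentiableAt ℝ (fun y => cofMatrix (jacMatrix n u y) i j) x := fun i j =>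
    (exists_hasFDerivAt_cofMatrix hd2 i j).choose_spec.1.differentiableAt
  have hψu : ∀ i, DifferentiableAt ℝ (fun y => ψ (u y) i) x := fun i =>
    (EuclideanSpace.proj i : EuclideanSpace ℝ (Fin n) →L[ℝ] ℝ).differentiableAt.comp x
      (hψd.comp x hd)
  have hterm : ∀ j, fderiv ℝ (fun y => ∑ i, ψ (u y) i * cofMatrix (jacMatrix n u y) i j) x
      (EuclideanSpace.single j 1) =
      ∑ i, (ψ (u x) i * fderiv ℝ (fun y => cofMatrix (jacMatrix n u y) i j) x
        (EuclideanSpace.single j 1) +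
        (jacMatrix n ψ (u x) * jacMatrix n u x) i j * cofMatrix (jacMatrix n u x) i j) := by
    intro j
    rw [fderiv_fun_sum fun i _ => (hψu i).fun_mul (hcof i j), sum_apply]
    refine Finset.sum_congr rfl fun i _ => ?_
    rw [fderiv_fun_mul (hψu i) (hcof i j), ← fderiv_comp_apply_single_eq_sum hd hψd]
    simp [mul_comm]
  have htrace : ∀ i, ∑ j, (jacMatrix n ψ (u x) * jacMatrix n u x) i j *
      cofMatrix (jacMatrix n u x) i j = jacMatrix n ψ (u x) i i * (jacMatrix n u x).det := by
    intro i
    change ((jacMatrix n ψ (u x) * jacMatrix n u x) * (jacMatrix n u x).adjugate) i i = _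
    rw [Matrix.mul_assoc, Matrix.mul_adjugate]
    simp [mul_comm]
  simp_rw [hterm]
  rw [Finset.sum_comm, Finset.sum_mul]
  refine Finset.sum_congr rfl fun i _ => ?_
  rw [Finset.sum_add_distrib, ← Finset.mul_sum, sum_fderiv_cofMatrix_jacMatrix_eq_zero hux,
    mul_zero, zero_add, htrace]
  rfl
end
end
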